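/- arXiv:2202.04921 — 2 statements merged into one kernel-verified Lean document; each statement's English description precedes it below -/
import Mathlib

section
/- Every subgraph of the complete bipartite graph K_{8,16} that contains no K_{2,2} has at most 38 edges, and every subgraph of K_{8,16} that contains no K_{4,4} has at most 90 edges; that is, z((8,16), K_{2,2}) ≤ 38 and z((8,16), K_{4,4}) ≤ 90. -/
/-- `G` (an edge set of a subgraph of `K_{m,n}`) contains `K_{s,t}`:
there are an `s`-subset `A` of the `X`-side and a `t`-subset `B` of the `Y`-side
with every pair in `A × B` an edge. -/
def ContainsK (m n s t : ℕ) (G : Finset (Fin m × Fin n)) : Prop :=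
  ∃ A : Finset (Fin m), ∃ B : Finset (Fin n),
    A.card = s ∧ B.card = t ∧ ∀ x ∈ A, ∀ y ∈ B, (x, y) ∈ G

/-- The bipartite complement of a subgraph of `K_{m,n}`. -/
def bipCompl (m n : ℕ) (G : Finset (Fin m × Fin n)) : Finset (Fin m × Fin n) :=
  Finset.univ \ G

/-- The neighborhood in `Y` of a vertex `x` of the `X`-side. -/
def nbhd (m n : ℕ) (G : Finset (Fin m × Fin n)) (x : Fin m) : Finset (Fin n) :=
  Finset.univ.filter (fun y => (x, y) ∈ G)

/-- The degree of a vertex `x` of the `X`-side. -/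
def degX (m n : ℕ) (G : Finset (Fin m × Fin n)) (x : Fin m) : ℕ :=
  (nbhd m n G x).card

/-- The neighbourhood in `X` of a vertex of the `Y`-side. -/
def colN (G : Finset (Fin 8 × Fin 16)) (y : Fin 16) : Finset (Fin 8) :=
  Finset.univ.filter (fun x => (x, y) ∈ G)

lemma sum_colN (G : Finset (Fin 8 × Fin 16)) : ∑ y, (colN G y).card = G.card := by
  rw [Finset.card_eq_sum_card_fiberwise (f := Prod.snd) (t := Finset.univ) (by simp)]
  refine Finset.sum_congr rfl fun y _ => ?_
  refine Finset.card_bij (fun x _ => (x, y)) ?_ ?_ ?_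
  · intro x hx
    simpa [colN] using hx
  · intro a _ b _ h
    simpa using h
  · rintro ⟨a, b⟩ h
    simp only [Finset.mem_filter] at h
    obtain ⟨h, rfl⟩ := h
    exact ⟨a, by simpa [colN] using h, rfl⟩

lemma col_le (G : Finset (Fin 8 × Fin 16)) (s t : ℕ) (h : ¬ ContainsK 8 16 s (t + 1) G)
    (A : Finset (Fin 8)) (hA : A.card = s) :
    (Finset.univ.filter (fun y => A ⊆ colN G y)).card ≤ t := by
  by_contra hc
  push Not at hc
  obtain ⟨B, hB, hBc⟩ := Finset.exists_subset_card_eq (Nat.succ_le_of_lt hc)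
  refine h ⟨A, B, hA, hBc, fun x hx y hy => ?_⟩
  have h1 := hB hy
  simp only [Finset.mem_filter, Finset.mem_univ, true_and] at h1
  have h2 := h1 hx
  simpa [colN] using h2

lemma double_count (N : Fin 16 → Finset (Fin 8)) (s t : ℕ)
    (h : ∀ A : Finset (Fin 8), A.card = s →
      (Finset.univ.filter (fun y => A ⊆ N y)).card ≤ t) :
    ∑ y, (N y).card.choose s ≤ Nat.choose 8 s * t := by
  have h1 : ∀ y, (N y).card.choose s =
      ∑ A ∈ Finset.powersetCard s (Finset.univ : Finset (Fin 8)), if A ⊆ N y then 1 else 0 := by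
    intro y
    rw [← Finset.card_powersetCard, ← Finset.card_filter]
    congr 1
    ext A
    simp [Finset.mem_powersetCard, and_comm]
  simp_rw [h1]
  rw [Finset.sum_comm]
  have h2 : Nat.choose 8 s = (Finset.powersetCard s (Finset.univ : Finset (Fin 8))).card := by
    simp
  rw [h2, ← smul_eq_mul]
  refine Finset.sum_le_card_nsmul _ _ _ fun A hA => ?_
  rw [← Finset.card_filter]
  exact h A (Finset.mem_powersetCard.1 hA).2

/-- Six naturals with sum two: four of them vanish. -/
lemma four_zero (x0 x1 x2 x3 x4 x5 : ℕ) (hx : x0 + x1 + x2 + x3 + x4 + x5 = 2) :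
    (x0 = 0 ∧ x1 = 0 ∧ x2 = 0 ∧ x3 = 0) ∨
    (x0 = 0 ∧ x1 = 0 ∧ x2 = 0 ∧ x4 = 0) ∨
    (x0 = 0 ∧ x1 = 0 ∧ x2 = 0 ∧ x5 = 0) ∨
    (x0 = 0 ∧ x1 = 0 ∧ x3 = 0 ∧ x4 = 0) ∨
    (x0 = 0 ∧ x1 = 0 ∧ x3 = 0 ∧ x5 = 0) ∨
    (x0 = 0 ∧ x1 = 0 ∧ x4 = 0 ∧ x5 = 0) ∨
    (x0 = 0 ∧ x2 = 0 ∧ x3 = 0 ∧ x4 = 0) ∨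
    (x0 = 0 ∧ x2 = 0 ∧ x3 = 0 ∧ x5 = 0) ∨
    (x0 = 0 ∧ x2 = 0 ∧ x4 = 0 ∧ x5 = 0) ∨
    (x0 = 0 ∧ x3 = 0 ∧ x4 = 0 ∧ x5 = 0) ∨
    (x1 = 0 ∧ x2 = 0 ∧ x3 = 0 ∧ x4 = 0) ∨
    (x1 = 0 ∧ x2 = 0 ∧ x3 = 0 ∧ x5 = 0) ∨
    (x1 = 0 ∧ x2 = 0 ∧ x4 = 0 ∧ x5 = 0) ∨
    (x1 = 0 ∧ x3 = 0 ∧ x4 = 0 ∧ x5 = 0) ∨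
    (x2 = 0 ∧ x3 = 0 ∧ x4 = 0 ∧ x5 = 0) := by
  have b0 : x0 ≤ 2 := by omega
  have b1 : x1 ≤ 2 - x0 := by omega
  have b2 : x2 ≤ 2 - x0 - x1 := by omega
  have b3 : x3 ≤ 2 - x0 - x1 - x2 := by omega
  have b4 : x4 ≤ 2 - x0 - x1 - x2 - x3 := by omega
  have b5 : x5 = 2 - x0 - x1 - x2 - x3 - x4 := by omega
  clear hx
  subst b5
  interval_cases x0 <;> interval_cases x1 <;> interval_cases x2 <;> interval_cases x3 <;>
    interval_cases x4 <;> decide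

set_option maxHeartbeats 4000000 in
/-- Multigraph on six vertices, every four spanning at most three edges. -/
lemma six (m01 m02 m03 m04 m05 m12 m13 m14 m15 m23 m24 m25 m34 m35 m45 : ℕ)
    (h0123 : m01 + m02 + m03 + m12 + m13 + m23 ≤ 3)
    (h0124 : m01 + m02 + m04 + m12 + m14 + m24 ≤ 3)
    (h0125 : m01 + m02 + m05 + m12 + m15 + m25 ≤ 3)
    (h0134 : m01 + m03 + m04 + m13 + m14 + m34 ≤ 3)
    (h0135 : m01 + m03 + m05 + m13 + m15 + m35 ≤ 3)
    (h0145 : m01 + m04 + m05 + m14 + m15 + m45 ≤ 3)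
    (h0234 : m02 + m03 + m04 + m23 + m24 + m34 ≤ 3)
    (h0235 : m02 + m03 + m05 + m23 + m25 + m35 ≤ 3)
    (h0245 : m02 + m04 + m05 + m24 + m25 + m45 ≤ 3)
    (h0345 : m03 + m04 + m05 + m34 + m35 + m45 ≤ 3)
    (h1234 : m12 + m13 + m14 + m23 + m24 + m34 ≤ 3)
    (h1235 : m12 + m13 + m15 + m23 + m25 + m35 ≤ 3)
    (h1245 : m12 + m14 + m15 + m24 + m25 + m45 ≤ 3)
    (h1345 : m13 + m14 + m15 + m34 + m35 + m45 ≤ 3)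
    (h2345 : m23 + m24 + m25 + m34 + m35 + m45 ≤ 3) :
    m01 + m02 + m03 + m04 + m05 + m12 + m13 + m14 + m15 + m23 + m24 + m25 + m34 + m35 + m45
      ≤ 6 := by
  by_contra hc
  push Not at hc
  have e7 : m01 + m02 + m03 + m04 + m05 + m12 + m13 + m14 + m15 + m23 + m24 + m25 + m34 + m35
      + m45 = 7 := by
    have h45 : 6 * (m01 + m02 + m03 + m04 + m05 + m12 + m13 + m14 + m15 + m23 + m24 + m25 + m34 + m35
      + m45) ≤ 45 := by linarith
    clear h0123 h0124 h0125 h0134 h0135 h0145 h0234 h0235 h0245 h0345 h1234 h1235 h1245 h1345 h2345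
    generalize m01 + m02 + m03 + m04 + m05 + m12 + m13 + m14 + m15 + m23 + m24 + m25 + m34 + m35
      + m45 = e at *
    omega
  clear hc
  -- five-sets span at most five edges, so all degrees are at least two
  have d0 : 2 ≤ m01 + m02 + m03 + m04 + m05 := by linarith
  have d1 : 2 ≤ m01 + m12 + m13 + m14 + m15 := by linarith
  have d2 : 2 ≤ m02 + m12 + m23 + m24 + m25 := by linarith
  have d3 : 2 ≤ m03 + m13 + m23 + m34 + m35 := by linarith
  have d4 : 2 ≤ m04 + m14 + m24 + m34 + m45 := by linarith
  have d5 : 2 ≤ m05 + m15 + m25 + m35 + m45 := by linarith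
  obtain ⟨x0, e0⟩ := Nat.exists_eq_add_of_le d0
  obtain ⟨x1, e1⟩ := Nat.exists_eq_add_of_le d1
  obtain ⟨x2, e2⟩ := Nat.exists_eq_add_of_le d2
  obtain ⟨x3, e3⟩ := Nat.exists_eq_add_of_le d3
  obtain ⟨x4, e4⟩ := Nat.exists_eq_add_of_le d4
  obtain ⟨x5, e5⟩ := Nat.exists_eq_add_of_le d5
  have hx : x0 + x1 + x2 + x3 + x4 + x5 = 2 := by linarith
  have k01 : m01 ≤ x0 + x1 := by linarith
  have k02 : m02 ≤ x0 + x2 := by linarith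
  have k03 : m03 ≤ x0 + x3 := by linarith
  have k04 : m04 ≤ x0 + x4 := by linarith
  have k05 : m05 ≤ x0 + x5 := by linarith
  have k12 : m12 ≤ x1 + x2 := by linarith
  have k13 : m13 ≤ x1 + x3 := by linarith
  have k14 : m14 ≤ x1 + x4 := by linarith
  have k15 : m15 ≤ x1 + x5 := by linarith
  have k23 : m23 ≤ x2 + x3 := by linarith
  have k24 : m24 ≤ x2 + x4 := by linarith
  have k25 : m25 ≤ x2 + x5 := by linarith
  have k34 : m34 ≤ x3 + x4 := by linarith
  have k35 : m35 ≤ x3 + x5 := by linarith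
  have k45 : m45 ≤ x4 + x5 := by linarith
  clear h0123 h0124 h0125 h0134 h0135 h0145 h0234 h0235 h0245 h0345 h1234 h1235 h1245 h1345 h2345
    d0 d1 d2 d3 d4 d5
  rcases four_zero _ _ _ _ _ _ hx with h | h | h | h | h | h | h | h | h | h | h | h | h | h | h <;>
    obtain ⟨z1, z2, z3, z4⟩ := h <;> linarith

/-- Total weight of the pairs indexed by `f`. -/
def tot {n : ℕ} (m : Fin 8 → Fin 8 → ℕ) (f : Fin n → Fin 8) : ℕ :=
  ∑ i, ∑ j, if i < j then m (f i) (f j) else 0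

def Four (m : Fin 8 → Fin 8 → ℕ) : Prop :=
  ∀ f : Fin 4 → Fin 8, Function.Injective f → tot m f ≤ 3

lemma tot6 (m : Fin 8 → Fin 8 → ℕ) (h : Four m) (f : Fin 6 → Fin 8)
    (hf : Function.Injective f) : tot m f ≤ 6 := by
  have key : ∀ a b c d : Fin 6, a < b → b < c → c < d →
      m (f a) (f b) + m (f a) (f c) + m (f a) (f d) + m (f b) (f c) + m (f b) (f d)
        + m (f c) (f d) ≤ 3 := by
    intro a b c d hab hbc hcd
    have := h ![f a, f b, f c, f d] (by
      have h1 : ![f a, f b, f c, f d] = f ∘ ![a, b, c, d] := by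
        funext i; fin_cases i <;> rfl
      rw [h1]
      refine hf.comp ?_
      refine StrictMono.injective ?_
      rw [Fin.strictMono_iff_lt_succ]
      intro i
      fin_cases i <;> simpa)
    simp [tot, Fin.sum_univ_succ] at this
    omega
  have := six _ _ _ _ _ _ _ _ _ _ _ _ _ _ _
    (key 0 1 2 3 (by decide) (by decide) (by decide))
    (key 0 1 2 4 (by decide) (by decide) (by decide))
    (key 0 1 2 5 (by decide) (by decide) (by decide))
    (key 0 1 3 4 (by decide) (by decide) (by decide))
    (key 0 1 3 5 (by decide) (by decide) (by decide))
    (key 0 1 4 5 (by decide) (by decide) (by decide))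
    (key 0 2 3 4 (by decide) (by decide) (by decide))
    (key 0 2 3 5 (by decide) (by decide) (by decide))
    (key 0 2 4 5 (by decide) (by decide) (by decide))
    (key 0 3 4 5 (by decide) (by decide) (by decide))
    (key 1 2 3 4 (by decide) (by decide) (by decide))
    (key 1 2 3 5 (by decide) (by decide) (by decide))
    (key 1 2 4 5 (by decide) (by decide) (by decide))
    (key 1 3 4 5 (by decide) (by decide) (by decide))
    (key 2 3 4 5 (by decide) (by decide) (by decide))
  have e : tot m f = ∑ i : Fin 6, ∑ j : Fin 6,
      if decide (i < j) = true then m (f i) (f j) else 0 := by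
    simp [tot]
  rw [e]
  simp only [Fin.sum_univ_six]
  simp (decide := true) only [if_true, if_false]
  linarith

/-- Averaging over the removal of one vertex. -/
lemma tot_avg {n : ℕ} (m : Fin 8 → Fin 8 → ℕ) (f : Fin (n + 2) → Fin 8) :
    ∑ k : Fin (n + 2), tot m (fun i => f (k.succAbove i)) = n * tot m f := by
  have h1 : ∀ k : Fin (n + 2), tot m (fun i => f (k.succAbove i)) =
      ∑ i, ∑ j, if k ≠ i ∧ k ≠ j then (if i < j then m (f i) (f j) else 0) else 0 := by
    intro k
    rw [Fin.sum_univ_succAbove _ k]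
    have : ∀ i : Fin (n+1), (∑ j, if k ≠ k.succAbove i ∧ k ≠ j then
        (if k.succAbove i < j then m (f (k.succAbove i)) (f j) else 0) else 0) =
        ∑ j, if i < j then m (f (k.succAbove i)) (f (k.succAbove j)) else 0 := by
      intro i
      rw [Fin.sum_univ_succAbove _ k]
      simp [Fin.succAbove_lt_succAbove_iff, Fin.ne_succAbove]
    simp_rw [this]
    simp [tot]
  simp_rw [h1]
  rw [Finset.sum_comm]
  rw [tot, Finset.mul_sum]
  refine Finset.sum_congr rfl fun i _ => ?_
  rw [Finset.sum_comm, Finset.mul_sum]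
  refine Finset.sum_congr rfl fun j _ => ?_
  by_cases hij : i < j
  · simp only [hij, if_true]
    rw [← Finset.sum_filter, Finset.sum_const, smul_eq_mul]
    congr 1
    have : (Finset.univ.filter (fun k : Fin (n+2) => k ≠ i ∧ k ≠ j)) =
        (Finset.univ.erase i).erase j := by
      ext k; simp [and_comm]
    rw [this, Finset.card_erase_of_mem (by simp [hij.ne']), Finset.card_erase_of_mem (by simp)]
    simp
  · simp [hij]

lemma tot7 (m : Fin 8 → Fin 8 → ℕ) (h : Four m) (f : Fin 7 → Fin 8)
    (hf : Function.Injective f) : tot m f ≤ 8 := by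
  have h1 := tot_avg (n := 5) m f
  have h2 : ∑ k : Fin 7, tot m (fun i => f (k.succAbove i)) ≤ ∑ k : Fin 7, 6 :=
    Finset.sum_le_sum fun k _ => tot6 m h _ (hf.comp Fin.succAbove_right_injective)
  simp at h2
  simp at h1
  omega

lemma tot8 (m : Fin 8 → Fin 8 → ℕ) (h : Four m) (f : Fin 8 → Fin 8)
    (hf : Function.Injective f) : tot m f ≤ 10 := by
  have h1 := tot_avg (n := 6) m f
  have h2 : ∑ k : Fin 8, tot m (fun i => f (k.succAbove i)) ≤ ∑ k : Fin 8, 8 :=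
    Finset.sum_le_sum fun k _ => tot7 m h _ (hf.comp Fin.succAbove_right_injective)
  simp at h2
  simp at h1
  omega

lemma tot5 (m : Fin 8 → Fin 8 → ℕ) (h : Four m) (f : Fin 5 → Fin 8)
    (hf : Function.Injective f) : tot m f ≤ 5 := by
  have h1 := tot_avg (n := 3) m f
  have h2 : ∑ k : Fin 5, tot m (fun i => f (k.succAbove i)) ≤ ∑ k : Fin 5, 3 :=
    Finset.sum_le_sum fun k _ => h _ (hf.comp Fin.succAbove_right_injective)
  simp at h2
  simp at h1
  omega

lemma tot_succ {n : ℕ} (m : Fin 8 → Fin 8 → ℕ) (f : Fin (n + 1) → Fin 8) :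
    tot m f = ∑ i : Fin n, m (f 0) (f i.succ) + tot m (fun i => f i.succ) := by
  simp [tot, Fin.sum_univ_succ]

lemma tot_remove {n : ℕ} (m : Fin 8 → Fin 8 → ℕ) (hs : ∀ a b, m a b = m b a)
    (f : Fin (n + 1) → Fin 8) (k : Fin (n + 1)) :
    tot m f = ∑ i : Fin n, m (f k) (f (k.succAbove i)) + tot m (fun i => f (k.succAbove i)) := by
  have e1 : tot m (fun i => f (k.succAbove i)) =
      ∑ i : Fin n, ∑ j, if k.succAbove i < k.succAbove j then
        m (f (k.succAbove i)) (f (k.succAbove j)) else 0 := by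
    simp [tot, Fin.succAbove_lt_succAbove_iff]
  rw [e1, tot, Fin.sum_univ_succAbove _ k, Fin.sum_univ_succAbove _ k]
  simp only [lt_irrefl, if_false, zero_add]
  have e2 : ∀ i : Fin n, (∑ j, if k.succAbove i < j then m (f (k.succAbove i)) (f j) else 0) =
      (if k.succAbove i < k then m (f k) (f (k.succAbove i)) else 0) +
      ∑ j, if k.succAbove i < k.succAbove j then
        m (f (k.succAbove i)) (f (k.succAbove j)) else 0 := by
    intro i
    rw [Fin.sum_univ_succAbove _ k, hs (f k)]
  simp_rw [e2]
  rw [Finset.sum_add_distrib, ← add_assoc, ← Finset.sum_add_distrib]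
  congr 1
  refine Finset.sum_congr rfl fun i _ => ?_
  rcases lt_or_gt_of_ne (Fin.ne_succAbove k i) with h | h
  · simp [h, h.le]
  · simp [h, h.le]

/-- With a singleton `{f 0}` and an edge `f 0, f 1`, there are at most seven edges. -/
lemma totB (m : Fin 8 → Fin 8 → ℕ) (hs : ∀ a b, m a b = m b a) (h : Four m)
    (f : Fin 8 → Fin 8) (hf : Function.Injective f)
    (h2 : ∀ g : Fin 4 → Fin 8, Function.Injective g → g 0 = f 0 → tot m g ≤ 2)
    (h01 : 1 ≤ m (f 0) (f 1)) : tot m f ≤ 7 := by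
  set r : Fin 6 → Fin 8 := fun i => f i.succ.succ with hr
  have hri : Function.Injective r :=
    hf.comp ((Fin.succ_injective _).comp (Fin.succ_injective _))
  set p : Fin 6 → ℕ := fun i => m (f 0) (r i) + m (f 1) (r i) with hp
  have key : ∀ y z : Fin 6, y ≠ z →
      m (f 0) (f 1) + p y + p z + m (r y) (r z) ≤ 2 := by
    intro y z hyz
    have := h2 ![f 0, f 1, r y, r z] (by
      have h1 : ![f 0, f 1, r y, r z] = f ∘ ![0, 1, y.succ.succ, z.succ.succ] := by
        funext i; fin_cases i <;> rfl
      rw [h1]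
      refine hf.comp ?_
      clear_value p r
      clear * - hyz
      revert y z
      decide) rfl
    simp [tot, Fin.sum_univ_succ] at this
    simp only [hp]
    omega
  have e : tot m f = m (f 0) (f 1) + ∑ i, p i + tot m r := by
    rw [tot_succ, tot_succ, Fin.sum_univ_succ]
    simp only [hp, Finset.sum_add_distrib, hr]
    simp
    ring
  have h01' : m (f 0) (f 1) ≤ 2 := by
    have := key 0 1 (by decide); omega
  have h6 := tot6 m h r hri
  by_cases hall : ∀ y, p y = 0
  · have hs0 : ∑ i, p i = 0 := by simp [hall]
    by_cases h22 : m (f 0) (f 1) = 2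
    · have : tot m r = 0 := by
        rw [tot]
        refine Finset.sum_eq_zero fun i _ => Finset.sum_eq_zero fun j _ => ?_
        split_ifs with hij
        · have := key i j hij.ne; omega
        · rfl
      omega
    · omega
  · push Not at hall
    obtain ⟨y, hy⟩ := hall
    have hy1 : p y ≤ 1 := by
      obtain ⟨z, hz⟩ := exists_ne y
      have := key y z hz.symm; omega
    have hm1 : m (f 0) (f 1) = 1 := by
      obtain ⟨z, hz⟩ := exists_ne y
      have := key y z hz.symm; omega
    have hsum : ∑ i, p i = p y := by
      refine Finset.sum_eq_single y (fun z _ hz => ?_) (by simp)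
      have := key y z hz.symm; omega
    have hrem := tot_remove m hs r y
    have hz : ∑ i : Fin 5, m (r y) (r (y.succAbove i)) = 0 := by
      refine Finset.sum_eq_zero fun i _ => ?_
      have := key y (y.succAbove i) (Fin.ne_succAbove y i); omega
    have h5 := tot5 m h (fun i => r (y.succAbove i)) (hri.comp Fin.succAbove_right_injective)
    omega

/-- Multiplicity of the pair `{a, b}`. -/
def mult (J : Finset (Fin 16)) (g : Fin 16 → Finset (Fin 8)) (a b : Fin 8) : ℕ :=
  (J.filter (fun j => g j = {a, b})).card

lemma mult_symm (J : Finset (Fin 16)) (g : Fin 16 → Finset (Fin 8)) (a b : Fin 8) :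
    mult J g a b = mult J g b a := by
  simp [mult, Finset.pair_comm a b]

/-- `tot` counts the members contained in the range of `f`. -/
lemma tot_mult {n : ℕ} (J : Finset (Fin 16)) (g : Fin 16 → Finset (Fin 8))
    (hg : ∀ j ∈ J, (g j).card = 2) (f : Fin n → Fin 8) (hf : Function.Injective f) :
    tot (mult J g) f = (J.filter (fun j => g j ⊆ Finset.univ.image f)).card := by
  have e : tot (mult J g) f = ∑ j ∈ J, ∑ q : Fin n × Fin n,
      if q.1 < q.2 ∧ g j = {f q.1, f q.2} then 1 else 0 := by
    rw [Finset.sum_comm, Fintype.sum_prod_type, tot]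
    refine Finset.sum_congr rfl fun a _ => Finset.sum_congr rfl fun b _ => ?_
    by_cases hab : a < b
    · simp [hab, mult]
    · simp [hab]
  rw [e, Finset.card_filter]
  refine Finset.sum_congr rfl fun j hj => ?_
  split_ifs with hsub
  · obtain ⟨x, y, hxy, hxyj⟩ := Finset.card_eq_two.1 (hg j hj)
    have hx : x ∈ Finset.univ.image f := hsub (by simp [hxyj])
    have hy : y ∈ Finset.univ.image f := hsub (by simp [hxyj])
    obtain ⟨a, -, rfl⟩ := Finset.mem_image.1 hx
    obtain ⟨b, -, rfl⟩ := Finset.mem_image.1 hy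
    have hab : a ≠ b := fun h => hxy (by rw [h])
    have aux : ∀ a b : Fin n, a < b → g j = {f a, f b} →
        (∑ q : Fin n × Fin n, if q.1 < q.2 ∧ g j = {f q.1, f q.2} then 1 else 0) = 1 := by
      intro a b hab hj
      rw [Finset.sum_eq_single (a, b)]
      · simp [hab, hj]
      · rintro ⟨c, d⟩ _ hne
        rw [if_neg]
        rintro ⟨hcd, h⟩
        rw [hj] at h
        simp only at hcd h
        have h1 : f a ∈ ({f c, f d} : Finset (Fin 8)) := by rw [← h]; simp
        have h2 : f b ∈ ({f c, f d} : Finset (Fin 8)) := by rw [← h]; simp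
        simp only [Finset.mem_insert, Finset.mem_singleton, hf.eq_iff] at h1 h2
        rcases h1 with rfl | rfl <;> rcases h2 with rfl | rfl
        · exact lt_irrefl _ hab
        · exact hne rfl
        · exact lt_asymm hab hcd
        · exact lt_irrefl _ hab
      · simp
    rcases lt_or_gt_of_ne hab with h | h
    · exact aux a b h hxyj
    · exact aux b a h (by rw [hxyj, Finset.pair_comm])
  · refine Finset.sum_eq_zero fun q _ => ?_
    rw [if_neg]
    rintro ⟨-, h⟩
    refine hsub ?_
    rw [h]
    intro x hx
    simp only [Finset.mem_insert, Finset.mem_singleton] at hx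
    rcases hx with rfl | rfl <;> simp

lemma tot_mult_univ (J : Finset (Fin 16)) (g : Fin 16 → Finset (Fin 8))
    (hg : ∀ j ∈ J, (g j).card = 2) (f : Fin 8 → Fin 8) (hf : Function.Injective f) :
    tot (mult J g) f = J.card := by
  rw [tot_mult J g hg f hf, Finset.image_univ_of_surjective (Finite.surjective_of_injective hf)]
  simp

lemma four_mult (J : Finset (Fin 16)) (g : Fin 16 → Finset (Fin 8))
    (hg : ∀ j ∈ J, (g j).card = 2)
    (h : ∀ S : Finset (Fin 8), S.card = 4 → (J.filter (fun j => g j ⊆ S)).card ≤ 3) :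
    Four (mult J g) := by
  intro f hf
  rw [tot_mult J g hg f hf]
  exact h _ (by rw [Finset.card_image_of_injective _ hf]; simp)

lemma lemmaA (J : Finset (Fin 16)) (g : Fin 16 → Finset (Fin 8))
    (hg : ∀ j ∈ J, (g j).card = 2)
    (h : ∀ S : Finset (Fin 8), S.card = 4 → (J.filter (fun j => g j ⊆ S)).card ≤ 3) :
    J.card ≤ 10 := by
  rw [← tot_mult_univ J g hg id Function.injective_id]
  exact tot8 _ (four_mult J g hg h) _ Function.injective_id

lemma lemmaB1 (J : Finset (Fin 16)) (g : Fin 16 → Finset (Fin 8)) (v x : Fin 8) (hvx : v ≠ x)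
    (hg : ∀ j ∈ J, (g j).card = 2)
    (h : ∀ S : Finset (Fin 8), S.card = 4 → (J.filter (fun j => g j ⊆ S)).card ≤ 3)
    (h2 : ∀ S : Finset (Fin 8), S.card = 4 → v ∈ S → (J.filter (fun j => g j ⊆ S)).card ≤ 2)
    (hj : ∃ j ∈ J, g j = {v, x}) : J.card ≤ 7 := by
  obtain ⟨f, hf0, hf1⟩ : ∃ f : Equiv.Perm (Fin 8), f 0 = v ∧ f 1 = x := by
    revert v x
    intro v x hvx _ _
    refine ⟨Equiv.swap (Equiv.swap 0 v 1) x * Equiv.swap 0 v, ?_, ?_⟩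
    · have : Equiv.swap 0 v 1 ≠ v := by
        intro h
        have h' : Equiv.swap 0 v 1 = Equiv.swap 0 v 0 := by rw [h]; simp
        exact absurd ((Equiv.swap 0 v).injective h') (by decide)
      simp [Equiv.swap_apply_of_ne_of_ne this.symm hvx]
    · simp
  rw [← tot_mult_univ J g hg f f.injective]
  refine totB _ (mult_symm J g) (four_mult J g hg h) f f.injective ?_ ?_
  · intro q hq hq0
    rw [tot_mult J g hg q hq]
    refine h2 _ (by rw [Finset.card_image_of_injective _ hq]; simp) ?_
    rw [← hf0, ← hq0]
    simp
  · obtain ⟨j, hjJ, hj⟩ := hj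
    exact Finset.card_pos.2 ⟨j, by simp [hjJ, hj, hf0, hf1]⟩

lemma lemmaB0 (J : Finset (Fin 16)) (g : Fin 16 → Finset (Fin 8)) (v : Fin 8)
    (hg : ∀ j ∈ J, (g j).card = 2)
    (h : ∀ S : Finset (Fin 8), S.card = 4 → (J.filter (fun j => g j ⊆ S)).card ≤ 3)
    (hj : ∀ j ∈ J, v ∉ g j) : J.card ≤ 8 := by
  have h7 := tot7 _ (four_mult J g hg h) v.succAbove Fin.succAbove_right_injective
  rw [tot_mult J g hg _ Fin.succAbove_right_injective, Finset.filter_true_of_mem] at h7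
  · exact h7
  · intro j hjJ x hx
    have : x ≠ v := fun h => hj j hjJ (h ▸ hx)
    obtain ⟨y, rfl⟩ := Fin.exists_succAbove_eq this
    simp

lemma lemmaB (J : Finset (Fin 16)) (g : Fin 16 → Finset (Fin 8)) (v : Fin 8)
    (hg : ∀ j ∈ J, (g j).card = 2)
    (h : ∀ S : Finset (Fin 8), S.card = 4 → (J.filter (fun j => g j ⊆ S)).card ≤ 3)
    (h2 : ∀ S : Finset (Fin 8), S.card = 4 → v ∈ S → (J.filter (fun j => g j ⊆ S)).card ≤ 2) :
    J.card ≤ 8 ∧ ((∃ j ∈ J, v ∈ g j) → J.card ≤ 7) := by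
  have h7 : (∃ j ∈ J, v ∈ g j) → J.card ≤ 7 := by
    rintro ⟨j, hjJ, hv⟩
    obtain ⟨x, y, hxy, e⟩ := Finset.card_eq_two.1 (hg j hjJ)
    rw [e] at hv
    simp only [Finset.mem_insert, Finset.mem_singleton] at hv
    rcases hv with rfl | rfl
    · exact lemmaB1 J g _ _ hxy hg h h2 ⟨j, hjJ, e⟩
    · exact lemmaB1 J g _ _ hxy.symm hg h h2 ⟨j, hjJ, by rw [e, Finset.pair_comm]⟩
  refine ⟨?_, h7⟩
  by_cases hex : ∃ j ∈ J, v ∈ g j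
  · exact (h7 hex).trans (by norm_num)
  · push Not at hex
    exact lemmaB0 J g v hg h hex

/-- Sixteen subsets of an 8-set, each 4-set containing at most three, have total size ≥ 38. -/
lemma main44 (c : Fin 16 → Finset (Fin 8))
    (h : ∀ S : Finset (Fin 8), S.card = 4 →
      (Finset.univ.filter (fun j => c j ⊆ S)).card ≤ 3)
    (hcount : ∑ j, (8 - (c j).card).choose 4 ≤ 210) : 38 ≤ ∑ j, (c j).card := by
  by_contra hlt
  push Not at hlt
  have hle8 : ∀ j, (c j).card ≤ 8 := fun j => by simpa using Finset.card_le_univ (c j)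
  -- few small sets
  have hpt : ∀ j, 35 + (10 * (if (c j).card = 1 then 1 else 0) +
      35 * (if (c j).card = 0 then 1 else 0)) ≤ (8 - (c j).card).choose 4 + 10 * (c j).card := by
    intro j
    have := hle8 j
    generalize (c j).card = k at *
    interval_cases k <;> decide
  have hs := Finset.sum_le_sum fun j (_ : j ∈ (Finset.univ : Finset (Fin 16))) => hpt j
  simp only [Finset.sum_add_distrib, ← Finset.mul_sum, ← Finset.card_filter] at hs
  simp only [Finset.sum_const, Finset.card_univ, Fintype.card_fin, smul_eq_mul] at hs
  set n1 := (Finset.univ.filter (fun j => (c j).card = 1)).card with hn1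
  have hn0 : (Finset.univ.filter (fun j => (c j).card = 0)).card = 0 := by omega
  have hn12 : n1 ≤ 2 := by omega
  have hpos : ∀ j, 1 ≤ (c j).card := by
    intro j
    by_contra hj
    rw [Finset.card_eq_zero, Finset.filter_eq_empty_iff] at hn0
    exact hn0 (Finset.mem_univ j) (by omega)
  by_cases hex : ∃ j0, (c j0).card = 1
  · obtain ⟨j0, hj0⟩ := hex
    obtain ⟨v, hv⟩ := Finset.card_eq_one.1 hj0
    have hg : ∀ j, ∃ T : Finset (Fin 8), (c j).card ≤ 2 →
        (c j ⊆ T ∧ T.card = 2 ∧ ((c j).card = 1 → v ∈ T)) := by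
      intro j
      by_cases h1 : (c j).card = 1
      · obtain ⟨T, hT, hT2⟩ := Finset.exists_superset_card_eq (s := insert v (c j)) (n := 2)
          (by have := Finset.card_insert_le v (c j); omega) (by simp)
        exact ⟨T, fun _ => ⟨(Finset.subset_insert _ _).trans hT, hT2,
          fun _ => hT (Finset.mem_insert_self _ _)⟩⟩
      · exact ⟨c j, fun h2 => ⟨subset_rfl, by have := hpos j; omega, fun h => absurd h h1⟩⟩
    choose g hg using hg
    set J := Finset.univ.filter (fun j => (c j).card ≤ 2 ∧ j ≠ j0) with hJ
    have hJm : ∀ j, j ∈ J ↔ (c j).card ≤ 2 ∧ j ≠ j0 := by simp [hJ]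
    have hsubs : ∀ S, J.filter (fun j => g j ⊆ S) ⊆
        (Finset.univ.filter (fun j => c j ⊆ S)).erase j0 := by
      intro S j hj
      simp only [Finset.mem_filter, hJm] at hj
      simp only [Finset.mem_erase, Finset.mem_filter, Finset.mem_univ, true_and]
      exact ⟨hj.1.2, (hg j hj.1.1).1.trans hj.2⟩
    have hB := lemmaB J g v (fun j hj => (hg j ((hJm j).1 hj).1).2.1)
      (fun S hS => (Finset.card_le_card ((hsubs S).trans (Finset.erase_subset _ _))).trans (h S hS))
      (fun S hS hvS => by
        refine (Finset.card_le_card (hsubs S)).trans ?_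
        rw [Finset.card_erase_of_mem (by simp [hv, hvS])]
        have := h S hS
        omega)
    -- total
    have hpt2 : ∀ j, 3 ≤ (c j).card + ((if j ∈ J then 1 else 0) +
        ((if (c j).card = 1 then 1 else 0) + (if j = j0 then 1 else 0))) := by
      intro j
      have := hpos j
      by_cases hjj : j = j0
      · subst hjj; simp only [hj0, if_true]; omega
      · by_cases h1 : (c j).card = 1
        · simp [hJm, h1, hjj]
        · by_cases h2 : (c j).card ≤ 2
          · have : j ∈ J := (hJm j).2 ⟨h2, hjj⟩
            simp [this]; omega
          · omega
    have hs2 := Finset.sum_le_sum fun j (_ : j ∈ (Finset.univ : Finset (Fin 16))) => hpt2 j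
    simp only [Finset.sum_add_distrib, ← Finset.card_filter] at hs2
    simp at hs2
    rw [← hn1] at hs2
    have hone : (Finset.univ.filter (fun i => i = j0)).card = 1 := by
      rw [Finset.card_eq_one]
      exact ⟨j0, by ext i; simp⟩
    rw [hone] at hs2
    by_cases h11 : n1 ≤ 1
    · have := hB.1
      omega
    · have : J.card ≤ 7 := by
        apply hB.2
        obtain ⟨j1, hj1, hne⟩ := Finset.exists_mem_ne (by rw [← hn1]; omega :
          1 < (Finset.univ.filter (fun j => (c j).card = 1)).card) j0
        simp only [Finset.mem_filter, Finset.mem_univ, true_and] at hj1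
        exact ⟨j1, (hJm j1).2 ⟨by omega, hne⟩, (hg j1 (by omega)).2.2 hj1⟩
      omega
  · push Not at hex
    set J := Finset.univ.filter (fun j => (c j).card ≤ 2) with hJ
    have hJm : ∀ j, j ∈ J ↔ (c j).card ≤ 2 := by simp [hJ]
    have hA := lemmaA J c
      (fun j hj => by have := (hJm j).1 hj; have := hpos j; have := hex j; omega)
      (fun S hS => (Finset.card_le_card (Finset.filter_subset_filter _
        (Finset.subset_univ _))).trans (h S hS))
    have hpt2 : ∀ j, 3 ≤ (c j).card + (if j ∈ J then 1 else 0) := by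
      intro j
      have := hpos j
      have := hex j
      split_ifs with hj
      · omega
      · rw [hJm] at hj; omega
    have hs2 := Finset.sum_le_sum fun j (_ : j ∈ (Finset.univ : Finset (Fin 16))) => hpt2 j
    simp only [Finset.sum_add_distrib, ← Finset.card_filter] at hs2
    simp at hs2
    omega

/-- z((8,16), K_{2,2}) ≤ 38 and z((8,16), K_{4,4}) ≤ 90. -/
theorem zarankiewicz_8_16 :
    (∀ G : Finset (Fin 8 × Fin 16), ¬ ContainsK 8 16 2 2 G → G.card ≤ 38) ∧
    (∀ G : Finset (Fin 8 × Fin 16), ¬ ContainsK 8 16 4 4 G → G.card ≤ 90) := by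
  have hle8 : ∀ (G : Finset (Fin 8 × Fin 16)) j, (colN G j).card ≤ 8 :=
    fun G j => by simpa using Finset.card_le_univ (colN G j)
  constructor
  · intro G hG
    have h1 := double_count (colN G) 2 1 (col_le G 2 1 hG)
    have hpt : ∀ j, 2 * (colN G j).card ≤ (colN G j).card.choose 2 + 3 := by
      intro j
      have := hle8 G j
      generalize (colN G j).card = k at *
      interval_cases k <;> decide
    have hs := Finset.sum_le_sum fun j (_ : j ∈ (Finset.univ : Finset (Fin 16))) => hpt j
    rw [← Finset.mul_sum, Finset.sum_add_distrib, sum_colN] at hs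
    have h28 : Nat.choose 8 2 = 28 := by decide
    rw [h28] at h1
    simp only [Finset.sum_const, Finset.card_univ, Fintype.card_fin, smul_eq_mul] at hs
    omega
  · intro G hG
    have hcol := col_le G 4 3 hG
    have h1 := double_count (colN G) 4 3 hcol
    have h70 : Nat.choose 8 4 = 70 := by decide
    rw [h70] at h1
    have hcc : ∀ j, ((colN G j)ᶜ).card = 8 - (colN G j).card := fun j => by
      rw [Finset.card_compl]; simp
    have h2 := main44 (fun j => (colN G j)ᶜ) (fun S hS => by
      have := hcol Sᶜ (by rw [Finset.card_compl, hS]; simp)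
      refine le_trans (le_of_eq ?_) this
      congr 1
      ext j
      simp only [Finset.mem_filter, Finset.mem_univ, true_and]
      exact compl_le_iff_compl_le) (by
      refine le_trans (le_of_eq (Finset.sum_congr rfl fun j _ => ?_)) h1
      have := hle8 G j
      simp only [hcc]
      congr 1
      omega)
    have h3 : ∑ j, ((colN G j)ᶜ).card + ∑ j, (colN G j).card = 128 := by
      rw [← Finset.sum_add_distrib, Finset.sum_congr rfl (g := fun _ => 8)]
      · simp
      · intro j _
        have := hle8 G j
        rw [hcc]; omega
    rw [sum_colN] at h3
    omega
end

section
/- Every subgraph of the complete bipartite graph K_{9,14} that contains no K_{2,2} has at most 39 edges, and every subgraph of K_{9,14} that contains no K_{4,4} has at most 88 edges; that is, z((9,14), K_{2,2}) ≤ 39 and z((9,14), K_{4,4}) ≤ 88. -/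
/-- `c ⊆ S` for bit masks. -/
noncomputable def zSub (c S : ℕ) : Bool := Nat.beq (Nat.land c S) c

noncomputable def zAll {α : Type} (p : α → Bool) (l : List α) : Bool :=
  List.rec true (fun a _ ih => cond (p a) ih false) l

noncomputable def zAny {α : Type} (p : α → Bool) (l : List α) : Bool :=
  List.rec false (fun a _ ih => cond (p a) true ih) l

/-- number of masks of `f` contained in `S`. -/
noncomputable def zCnt (S : ℕ) (f : List ℕ) : ℕ :=
  List.rec 0 (fun c _ ih => cond (zSub c S) (Nat.add ih 1) ih) f

/-- size of an 8-bit mask. -/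
noncomputable def zPc (m : ℕ) : ℕ :=
  Nat.add (Nat.mod m 2) (Nat.add (Nat.mod (Nat.div m 2) 2) (Nat.add (Nat.mod (Nat.div m 4) 2)
    (Nat.add (Nat.mod (Nat.div m 8) 2) (Nat.add (Nat.mod (Nat.div m 16) 2)
    (Nat.add (Nat.mod (Nat.div m 32) 2) (Nat.add (Nat.mod (Nat.div m 64) 2)
    (Nat.mod (Nat.div m 128) 2)))))))

/-- relabel the mask `m`: bit `i` of the result is bit `o[i]` of `m`. -/
noncomputable def zReorder (m : ℕ) (o : List ℕ) : ℕ :=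
  List.rec 0 (fun a _ ih => Nat.add (Nat.mod (Nat.shiftRight m a) 2) (Nat.mul 2 ih)) o

noncomputable def zIns (key : ℕ → ℕ) (a : ℕ) (l : List ℕ) : List ℕ :=
  List.rec [a] (fun b l ih => cond (Nat.ble (key a) (key b)) (a :: b :: l) (b :: ih)) l

noncomputable def zSort (key : ℕ → ℕ) (l : List ℕ) : List ℕ :=
  List.rec [] (fun a _ ih => zIns key a ih) l

/-- spread the 8 bits of a mask to 8 fields of 48 bits -/
noncomputable def zSp (c : ℕ) : ℕ :=
  Nat.land (Nat.mul c
    1093625362391513732861820016530308331298536912140569296408793048269325676805573609417719063200661505)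
    139984046386113260483076552323936769829629381004690729274846099254769870219648685538816173958204751873

noncomputable def zD1 (f : List ℕ) : ℕ :=
  List.rec 0 (fun c _ ih => Nat.add (Nat.mul (Nat.pow 7 (Nat.sub 3 (zPc c))) (zSp c)) ih) f

noncomputable def zD2 (D : ℕ) (f : List ℕ) : ℕ :=
  List.rec 0 (fun c _ ih => Nat.add (Nat.mul (Nat.pow (Nat.mod (Nat.land D
    (Nat.mul (zSp c) 281474976710655)) 281474976710655) 3) (zSp c)) ih) f

/-- The relabelling used to normalise the family `f` (its choice is a heuristic). -/
noncomputable def zOrd (f : List ℕ) : List ℕ :=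
  zSort (fun v => Nat.mod (Nat.shiftRight (zD2 (zD1 f) f) (Nat.mul 48 v)) 281474976710656)
    [0, 1, 2, 3, 4, 5, 6, 7]

noncomputable def zMapR (o f : List ℕ) : List ℕ :=
  List.rec [] (fun c _ ih => zReorder c o :: ih) f

noncomputable def zNorm (f : List ℕ) : List ℕ := zSort (fun x => x) (zMapR (zOrd f) f)

noncomputable def zTot (f : List ℕ) : ℕ := List.rec 0 (fun c _ ih => Nat.add (zPc c) ih) f

noncomputable def zEq (l : List ℕ) : List ℕ → Bool :=
  List.rec (fun m => List.rec true (fun _ _ _ => false) m)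
    (fun a _ ih m => List.rec false (fun b m _ => cond (Nat.beq a b) (ih m) false) m) l

noncomputable def zMem (a : List ℕ) (L : List (List ℕ)) : Bool := zAny (zEq a) L

/-- the members of `K4` which already contain three members of `f` -/
noncomputable def zSat (f : List ℕ) (K4 : List ℕ) : List ℕ :=
  List.rec [] (fun S _ ih => cond (Nat.ble 3 (zCnt S f)) (S :: ih) ih) K4

/-- one branch of the step check: all masks of size `p` from the list `ms` -/
noncomputable def zBr (r : ℕ) (f st : List ℕ) (L : List (List ℕ)) (p : ℕ) (ms : List ℕ) : Bool :=
  cond (zAll (fun c => Nat.ble (zPc c) p) f)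
    (cond (Nat.ble (Nat.add (zTot f) (Nat.mul r p)) 32)
      (zAll (fun s => cond (zAny (zSub s) st) true (zMem (zNorm (s :: f)) L)) ms) true) true

def zE0 : List ℕ := [0]
def zE1 : List ℕ := [1, 2, 4, 8, 16, 32, 64, 128]
def zE2 : List ℕ := [
  3, 5, 6, 9, 10, 12, 17, 18, 20, 24, 33, 34, 36, 40, 48, 65, 66, 68, 72, 80, 96, 129, 130,
  132, 136, 144, 160, 192]
def zE3 : List ℕ := [
  7, 11, 13, 14, 19, 21, 22, 25, 26, 28, 35, 37, 38, 41, 42, 44, 49, 50, 52, 56, 67, 69, 70,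
  73, 74, 76, 81, 82, 84, 88, 97, 98, 100, 104, 112, 131, 133, 134, 137, 138, 140, 145, 146,
  148, 152, 161, 162, 164, 168, 176, 193, 194, 196, 200, 208, 224]
def zE4 : List ℕ := [
  15, 23, 27, 29, 30, 39, 43, 45, 46, 51, 53, 54, 57, 58, 60, 71, 75, 77, 78, 83, 85, 86, 89,
  90, 92, 99, 101, 102, 105, 106, 108, 113, 114, 116, 120, 135, 139, 141, 142, 147, 149, 150,
  153, 154, 156, 163, 165, 166, 169, 170, 172, 177, 178, 180, 184, 195, 197, 198, 201, 202,
  204, 209, 210, 212, 216, 225, 226, 228, 232, 240]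
def zE5 : List ℕ := [
  31, 47, 55, 59, 61, 62, 79, 87, 91, 93, 94, 103, 107, 109, 110, 115, 117, 118, 121, 122,
  124, 143, 151, 155, 157, 158, 167, 171, 173, 174, 179, 181, 182, 185, 186, 188, 199, 203,
  205, 206, 211, 213, 214, 217, 218, 220, 227, 229, 230, 233, 234, 236, 241, 242, 244, 248]

noncomputable def zStepF (r : ℕ) (L : List (List ℕ)) (f st : List ℕ) : Bool :=
  (Nat.ble 33 (Nat.add (zTot f) (Nat.mul r 4))).and ((zBr r f st L 0 zE0).and
    ((zBr r f st L 1 zE1).and ((zBr r f st L 2 zE2).and (zBr r f st L 3 zE3))))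

noncomputable def zStep (r : ℕ) (L L' : List (List ℕ)) : Bool :=
  zAll (fun f => zStepF r L' f (zSat f zE4)) L

/-- `true` if it is impossible to delete at most `d` of the masks in the list `l` so that
the others, together with `kept`, have at most three members in every 5-set. -/
noncomputable def zFin (l : List ℕ) : List ℕ → ℕ → Bool :=
  List.rec (fun _ _ => false) (fun c _ ih kept d =>
    (Nat.rec true (fun d _ => ih kept d) d : Bool).and
    (cond (zAny (fun S => cond (zSub c S) (Nat.ble 3 (zCnt S kept)) false) zE5) true
      (ih (c :: kept) d))) l

noncomputable def zFinal (L : List (List ℕ)) : Bool :=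
  zAll (fun f => (Nat.ble 32 (zTot f)).and (zFin f [] 5)) L

def zL0 : List (List ℕ) := [
  []]

def zL1 : List (List ℕ) := [
  [0], [128], [192]]

def zL2 : List (List ℕ) := [
  [0, 0], [0, 128], [0, 192], [64, 128], [128, 128], [96, 128], [128, 192], [48, 192], [160, 192],
  [192, 192]]

def zL3 : List (List ℕ) := [
  [0, 0, 0], [0, 0, 128], [0, 0, 192], [0, 64, 128], [0, 128, 128], [0, 96, 128], [0, 128, 192],
  [0, 48, 192], [0, 160, 192], [0, 192, 192], [32, 64, 128], [64, 128, 128], [48, 64, 128], [32,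
  128, 192], [64, 128, 192], [128, 128, 128], [96, 128, 128], [128, 128, 192], [24, 96, 128], [80,
  96, 128], [96, 96, 128], [48, 128, 192], [96, 128, 192], [128, 160, 192], [128, 192, 192], [12,
  48, 192], [24, 160, 192], [48, 192, 192], [80, 160, 192], [96, 160, 192], [144, 160, 192], [160,
  192, 192], [192, 192, 192]]

def zL4 : List (List ℕ) := [
  [0, 24, 96, 128], [0, 12, 48, 192], [0, 24, 160, 192], [24, 32, 64, 128], [12, 48, 64, 128],
  [40, 48, 64, 128], [24, 32, 128, 192], [24, 96, 128, 128], [6, 24, 96, 128], [12, 80, 96, 128],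
  [24, 96, 96, 128], [40, 80, 96, 128], [12, 48, 128, 192], [24, 96, 128, 192], [72, 80, 96, 128],
  [40, 48, 128, 192], [24, 128, 160, 192], [3, 12, 48, 192], [6, 24, 160, 192], [12, 48, 192,
  192], [12, 80, 160, 192], [68, 72, 144, 160], [40, 48, 192, 192], [40, 80, 160, 192], [24, 96,
  160, 192], [12, 144, 160, 192], [72, 144, 160, 192], [24, 160, 192, 192], [136, 144, 160, 192]]

def zL5 : List (List ℕ) := [
  [0, 6, 24, 96, 128], [0, 3, 12, 48, 192], [0, 6, 24, 160, 192], [0, 68, 72, 144, 160], [6, 24,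
  32, 64, 128], [20, 24, 32, 64, 128], [3, 12, 48, 64, 128], [6, 40, 48, 64, 128], [20, 40, 48,
  64, 128], [6, 24, 32, 128, 192], [36, 40, 48, 64, 128], [20, 24, 32, 128, 192], [6, 24, 96, 128,
  128], [3, 12, 80, 96, 128], [6, 24, 96, 96, 128], [6, 40, 80, 96, 128], [3, 12, 48, 128, 192],
  [6, 24, 96, 128, 192], [34, 36, 72, 80, 128], [20, 24, 96, 96, 128], [20, 40, 80, 96, 128], [6,
  72, 80, 96, 128], [36, 72, 80, 96, 128], [6, 40, 48, 128, 192], [40, 48, 68, 128, 192], [20, 40,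
  48, 128, 192], [6, 24, 128, 160, 192], [36, 40, 80, 128, 192], [64, 132, 136, 144, 160], [36,
  40, 48, 128, 192], [20, 24, 128, 160, 192], [3, 12, 48, 192, 192], [3, 12, 80, 160, 192], [3,
  68, 72, 144, 160], [6, 40, 48, 192, 192], [40, 48, 66, 132, 192], [6, 40, 80, 160, 192], [6, 24,
  96, 160, 192], [3, 12, 144, 160, 192], [6, 72, 144, 160, 192], [6, 24, 160, 192, 192], [20, 40,
  48, 192, 192], [34, 36, 72, 144, 192], [20, 40, 80, 160, 192], [36, 72, 144, 160, 192], [20, 24,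
  96, 160, 192], [36, 40, 66, 144, 192], [10, 12, 144, 160, 192], [20, 24, 160, 192, 192], [36,
  96, 136, 144, 192], [68, 72, 144, 160, 192], [24, 40, 48, 192, 192], [96, 96, 132, 136, 144],
  [24, 40, 80, 160, 192], [24, 24, 96, 160, 192], [6, 136, 144, 160, 192], [68, 136, 144, 160,
  192], [132, 136, 144, 160, 192]]

def zL6 : List (List ℕ) := [
  [0, 3, 68, 72, 144, 160], [3, 20, 24, 32, 64, 128], [10, 20, 24, 32, 64, 128], [18, 20, 24, 32,
  64, 128], [3, 20, 40, 48, 64, 128], [17, 18, 36, 40, 64, 128], [10, 20, 40, 48, 64, 128], [3,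
  36, 40, 48, 64, 128], [18, 36, 40, 48, 64, 128], [3, 20, 24, 32, 128, 192], [10, 20, 24, 32,
  128, 192], [32, 64, 130, 132, 136, 144], [18, 20, 24, 32, 128, 192], [3, 20, 24, 96, 96, 128],
  [20, 24, 33, 66, 96, 128], [3, 20, 40, 80, 96, 128], [3, 36, 72, 80, 96, 128], [3, 40, 48, 68,
  128, 192], [10, 20, 24, 96, 96, 128], [17, 18, 36, 72, 96, 128], [10, 20, 40, 80, 96, 128], [18,
  36, 72, 80, 96, 128], [3, 20, 40, 48, 128, 192], [20, 40, 48, 66, 128, 192], [3, 36, 40, 80,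
  128, 192], [18, 36, 48, 72, 128, 192], [18, 20, 33, 72, 96, 128], [5, 6, 72, 80, 96, 128], [18,
  48, 68, 72, 96, 128], [32, 66, 68, 136, 144, 192], [17, 18, 36, 40, 128, 192], [48, 48, 66, 68,
  72, 128], [12, 20, 40, 80, 96, 128], [10, 20, 40, 48, 128, 192], [3, 64, 132, 136, 144, 160],
  [34, 64, 132, 136, 144, 160], [3, 36, 40, 48, 128, 192], [36, 40, 48, 66, 128, 192], [18, 36,
  40, 48, 128, 192], [3, 20, 24, 128, 160, 192], [18, 40, 48, 68, 128, 192], [10, 20, 24, 128,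
  160, 192], [34, 36, 40, 48, 128, 192], [64, 130, 132, 136, 144, 160], [18, 20, 24, 128, 160,
  192], [3, 20, 40, 48, 192, 192], [17, 34, 48, 68, 136, 192], [3, 20, 40, 80, 160, 192], [3, 36,
  72, 144, 160, 192], [17, 18, 36, 40, 192, 192], [20, 24, 33, 66, 160, 192], [3, 20, 24, 96, 160,
  192], [18, 20, 33, 72, 160, 192], [10, 12, 65, 144, 160, 192], [3, 20, 24, 160, 192, 192], [3,
  36, 96, 136, 144, 192], [3, 68, 72, 144, 160, 192], [10, 20, 40, 48, 192, 192], [6, 24, 40, 48,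
  192, 192], [3, 96, 96, 132, 136, 144], [48, 48, 66, 132, 136, 192], [17, 40, 48, 66, 132, 192],
  [12, 18, 72, 96, 144, 160], [10, 20, 24, 96, 160, 192], [33, 66, 96, 132, 136, 144], [18, 48,
  96, 132, 136, 192], [18, 36, 48, 136, 192, 192], [20, 34, 80, 136, 160, 192], [34, 72, 80, 132,
  160, 192], [17, 18, 36, 72, 160, 192], [10, 20, 96, 96, 136, 144], [10, 20, 40, 96, 144, 192],
  [6, 24, 40, 80, 160, 192], [18, 36, 72, 144, 160, 192], [6, 24, 24, 96, 160, 192], [3, 68, 136,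
  144, 160, 192], [9, 10, 68, 144, 160, 192], [18, 36, 80, 136, 160, 192], [34, 68, 136, 144, 160,
  192], [34, 68, 72, 144, 160, 192], [10, 20, 40, 80, 160, 192], [12, 20, 40, 80, 160, 192], [24,
  40, 80, 132, 160, 192], [12, 20, 24, 96, 160, 192], [48, 80, 96, 130, 132, 136], [24, 40, 48,
  132, 192, 192], [17, 36, 48, 66, 136, 192], [10, 20, 72, 96, 144, 160], [12, 18, 40, 96, 144,
  192], [65, 66, 68, 136, 144, 160], [36, 40, 48, 130, 192, 192], [66, 68, 96, 136, 144, 160], [5,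
  6, 136, 144, 160, 192], [6, 68, 136, 144, 160, 192], [66, 68, 136, 144, 160, 192], [34, 36, 40,
  144, 192, 192], [96, 96, 130, 132, 136, 144], [3, 132, 136, 144, 160, 192], [66, 132, 136, 144,
  160, 192], [130, 132, 136, 144, 160, 192]]

def zL7 : List (List ℕ) := [
  [5, 10, 20, 24, 32, 64, 128], [9, 18, 20, 24, 32, 64, 128], [16, 32, 64, 129, 130, 132, 136],
  [5, 10, 20, 40, 48, 64, 128], [9, 18, 36, 40, 48, 64, 128], [9, 24, 34, 36, 48, 64, 128], [16,
  32, 65, 66, 132, 136, 192], [6, 10, 20, 40, 48, 64, 128], [5, 10, 20, 24, 32, 128, 192], [17,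
  32, 64, 130, 132, 136, 144], [9, 18, 20, 24, 32, 128, 192], [16, 33, 34, 36, 40, 128, 192], [32,
  64, 129, 130, 132, 136, 144], [5, 10, 20, 24, 96, 96, 128], [24, 24, 33, 66, 68, 96, 128], [6,
  9, 36, 48, 72, 80, 128], [9, 24, 48, 66, 68, 96, 128], [10, 17, 40, 68, 80, 96, 128], [17, 32,
  68, 72, 130, 144, 192], [5, 10, 48, 48, 68, 72, 128], [5, 10, 20, 48, 72, 96, 128], [3, 12, 20,
  40, 80, 96, 128], [9, 18, 36, 64, 136, 144, 160], [10, 20, 40, 48, 65, 128, 192], [9, 18, 40,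
  68, 80, 96, 128], [17, 34, 64, 132, 136, 144, 160], [18, 36, 40, 48, 65, 128, 192], [9, 20, 40,
  48, 66, 128, 192], [17, 36, 40, 48, 66, 128, 192], [17, 32, 66, 68, 136, 144, 192], [5, 10, 20,
  40, 80, 96, 128], [6, 10, 20, 40, 80, 96, 128], [12, 20, 40, 66, 80, 96, 128], [5, 10, 20, 40,
  48, 128, 192], [9, 18, 36, 40, 48, 128, 192], [9, 18, 40, 48, 68, 128, 192], [5, 10, 36, 48, 72,
  80, 128], [6, 9, 20, 48, 72, 96, 128], [33, 34, 48, 68, 72, 80, 128], [3, 34, 64, 132, 136, 144,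
  160], [32, 65, 66, 132, 136, 144, 192], [9, 24, 34, 36, 48, 128, 192], [17, 18, 36, 40, 48, 128,
  192], [48, 48, 64, 129, 130, 132, 136], [6, 10, 20, 40, 48, 128, 192], [5, 10, 20, 24, 128, 160,
  192], [34, 36, 40, 48, 65, 128, 192], [32, 65, 130, 132, 136, 144, 192], [17, 34, 36, 40, 48,
  128, 192], [9, 18, 20, 24, 128, 160, 192], [65, 66, 68, 72, 80, 128, 160], [17, 18, 20, 24, 128,
  160, 192], [64, 129, 130, 132, 136, 144, 160], [5, 10, 20, 40, 48, 192, 192], [24, 24, 33, 66,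
  132, 160, 192], [5, 10, 48, 68, 80, 136, 160], [10, 24, 33, 80, 132, 160, 192], [9, 24, 34, 80,
  132, 160, 192], [17, 34, 68, 80, 136, 160, 192], [5, 10, 48, 48, 68, 136, 192], [5, 10, 20, 48,
  96, 136, 192], [5, 10, 20, 48, 72, 160, 192], [3, 12, 20, 40, 80, 160, 192], [3, 24, 40, 80,
  132, 160, 192], [12, 17, 34, 72, 144, 160, 192], [10, 17, 36, 72, 144, 160, 192], [9, 18, 36,
  72, 144, 160, 192], [17, 34, 68, 136, 144, 160, 192], [5, 6, 24, 40, 48, 192, 192], [9, 48, 48,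
  72, 130, 132, 192], [48, 48, 65, 66, 132, 136, 192], [5, 6, 24, 40, 80, 160, 192], [6, 9, 36,
  48, 80, 136, 192], [5, 10, 48, 80, 96, 132, 136], [9, 40, 48, 80, 130, 132, 192], [9, 18, 40,
  48, 132, 192, 192], [10, 17, 40, 80, 132, 160, 192], [17, 48, 68, 72, 130, 160, 192], [17, 34,
  68, 72, 144, 160, 192], [5, 6, 24, 24, 96, 160, 192], [5, 10, 20, 24, 96, 160, 192], [3, 12, 20,
  24, 96, 160, 192], [24, 40, 48, 65, 130, 132, 192], [3, 24, 40, 48, 132, 192, 192], [5, 10, 36,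
  48, 80, 136, 192], [6, 9, 20, 48, 96, 136, 192], [9, 18, 40, 80, 132, 160, 192], [17, 48, 66,
  68, 136, 160, 192], [48, 65, 66, 80, 132, 136, 160], [17, 68, 72, 80, 130, 160, 160], [17, 66,
  68, 96, 136, 144, 160], [34, 36, 72, 80, 129, 160, 192], [6, 33, 68, 136, 144, 160, 192], [33,
  66, 68, 136, 144, 160, 192], [17, 66, 68, 80, 136, 160, 160], [9, 24, 48, 96, 130, 132, 192],
  [17, 68, 72, 96, 130, 144, 160], [6, 10, 20, 40, 48, 192, 192], [48, 48, 65, 130, 132, 136,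
  192], [6, 9, 48, 68, 80, 136, 160], [5, 10, 48, 68, 96, 136, 144], [18, 33, 68, 80, 136, 160,
  192], [17, 34, 72, 80, 132, 160, 192], [5, 10, 20, 72, 96, 144, 160], [5, 10, 20, 80, 96, 136,
  160], [6, 12, 18, 72, 96, 144, 160], [20, 24, 36, 72, 130, 160, 192], [24, 40, 68, 80, 130, 160,
  192], [12, 18, 36, 72, 144, 160, 192], [3, 34, 96, 132, 136, 144, 192], [33, 66, 96, 132, 136,
  144, 192], [12, 24, 36, 80, 130, 160, 192], [24, 66, 72, 96, 132, 144, 160], [24, 40, 80, 130,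
  132, 160, 192], [24, 40, 66, 80, 132, 160, 192], [33, 34, 72, 80, 132, 160, 192], [5, 10, 20,
  96, 96, 136, 144], [6, 10, 20, 96, 96, 136, 144], [5, 10, 20, 40, 96, 144, 192], [6, 10, 20, 40,
  96, 144, 192], [6, 6, 24, 40, 80, 160, 192], [5, 34, 68, 136, 144, 160, 192], [33, 66, 132, 136,
  144, 160, 192], [12, 20, 40, 80, 130, 160, 192], [33, 34, 68, 72, 144, 160, 192], [5, 10, 20,
  40, 80, 160, 192], [6, 10, 20, 40, 80, 160, 192], [48, 80, 96, 129, 130, 132, 136], [6, 10, 20,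
  72, 96, 144, 160], [6, 12, 18, 40, 96, 144, 192], [33, 34, 96, 132, 136, 144, 192], [65, 66, 68,
  136, 144, 160, 192], [65, 96, 96, 130, 132, 136, 144], [3, 66, 132, 136, 144, 160, 192], [65,
  66, 132, 136, 144, 160, 192], [3, 3, 132, 136, 144, 160, 192], [65, 130, 132, 136, 144, 160,
  192], [129, 130, 132, 136, 144, 160, 192]]

def zL8 : List (List ℕ) := [
  [3, 5, 10, 20, 24, 32, 64, 128], [3, 9, 20, 22, 24, 32, 64, 128], [5, 10, 17, 18, 28, 32, 64,
  128], [5, 6, 8, 16, 33, 66, 128, 224], [6, 8, 16, 34, 65, 68, 128, 224], [7, 9, 18, 20, 24, 32,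
  64, 128], [5, 6, 8, 16, 34, 68, 128, 224], [3, 5, 10, 20, 40, 48, 64, 128], [6, 10, 20, 33, 40,
  48, 64, 128], [3, 5, 10, 20, 24, 32, 128, 192], [3, 5, 10, 20, 24, 96, 96, 128], [3, 6, 9, 36,
  48, 72, 80, 128], [10, 12, 18, 36, 65, 80, 96, 128], [12, 20, 32, 66, 72, 129, 144, 192], [6, 9,
  18, 36, 64, 136, 144, 160], [6, 12, 18, 40, 65, 80, 96, 128], [12, 33, 36, 48, 66, 72, 80, 128],
  [12, 20, 40, 64, 129, 130, 144, 160], [12, 20, 32, 65, 72, 130, 144, 192], [3, 5, 10, 48, 48,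
  68, 72, 128], [3, 5, 10, 20, 48, 72, 96, 128], [3, 3, 12, 20, 40, 80, 96, 128], [6, 10, 20, 40,
  48, 65, 128, 192], [6, 10, 20, 40, 65, 80, 96, 128], [3, 5, 10, 20, 40, 80, 96, 128], [3, 5, 10,
  20, 40, 48, 128, 192], [6, 10, 20, 33, 40, 48, 128, 192], [3, 5, 10, 36, 48, 72, 80, 128], [3,
  6, 9, 20, 48, 72, 96, 128], [3, 5, 10, 20, 24, 128, 160, 192], [3, 5, 10, 20, 40, 48, 192, 192],
  [6, 24, 24, 34, 68, 129, 160, 192], [3, 5, 10, 48, 68, 80, 136, 160], [12, 18, 24, 34, 68, 129,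
  160, 192], [12, 18, 20, 34, 72, 129, 160, 192], [12, 20, 40, 65, 80, 130, 160, 192], [3, 12, 20,
  40, 66, 144, 160, 192], [10, 12, 17, 34, 68, 144, 160, 192], [9, 20, 36, 66, 96, 136, 144, 192],
  [6, 12, 24, 34, 80, 129, 160, 192], [6, 12, 17, 34, 72, 144, 160, 192], [20, 40, 65, 68, 72,
  130, 144, 160], [5, 24, 66, 72, 96, 132, 144, 160], [5, 24, 66, 80, 96, 132, 136, 160], [24, 34,
  40, 68, 80, 129, 160, 192], [12, 17, 36, 72, 130, 144, 160, 192], [6, 10, 24, 36, 80, 129, 160,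
  192], [24, 33, 40, 68, 80, 130, 160, 192], [24, 33, 40, 66, 80, 132, 160, 192], [3, 5, 10, 48,
  48, 68, 136, 192], [12, 12, 18, 34, 80, 129, 160, 192], [3, 5, 10, 20, 48, 96, 136, 192], [3,
  12, 20, 34, 72, 144, 160, 192], [9, 20, 36, 66, 80, 136, 160, 192], [3, 5, 10, 20, 48, 72, 160,
  192], [10, 20, 24, 34, 68, 129, 160, 192], [3, 3, 12, 20, 40, 80, 160, 192], [6, 10, 17, 36, 72,
  144, 160, 192], [6, 6, 24, 40, 80, 129, 160, 192], [3, 12, 18, 36, 72, 144, 160, 192], [3, 5, 6,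
  24, 40, 48, 192, 192], [3, 5, 6, 24, 40, 80, 160, 192], [6, 10, 20, 40, 48, 129, 192, 192], [12,
  20, 40, 65, 66, 144, 160, 192], [3, 6, 9, 36, 48, 80, 136, 192], [10, 12, 20, 34, 80, 129, 160,
  192], [12, 20, 40, 66, 80, 129, 160, 192], [3, 5, 10, 48, 80, 96, 132, 136], [6, 20, 24, 34, 72,
  129, 160, 192], [12, 20, 65, 72, 96, 130, 144, 160], [20, 24, 36, 72, 129, 130, 160, 192], [24,
  40, 65, 80, 130, 132, 160, 192], [6, 12, 18, 40, 80, 129, 160, 192], [36, 40, 48, 66, 72, 129,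
  144, 192], [33, 40, 48, 68, 72, 130, 144, 192], [3, 5, 6, 24, 24, 96, 160, 192], [3, 5, 10, 20,
  24, 96, 160, 192], [3, 3, 12, 20, 24, 96, 160, 192], [3, 5, 10, 36, 48, 80, 136, 192], [3, 6, 9,
  20, 48, 96, 136, 192], [6, 10, 20, 40, 80, 129, 160, 192], [36, 40, 48, 65, 72, 130, 144, 192],
  [33, 40, 48, 66, 72, 132, 144, 192], [12, 48, 65, 68, 80, 130, 136, 160], [24, 33, 40, 96, 130,
  132, 144, 192], [34, 40, 48, 65, 72, 132, 144, 192], [12, 24, 36, 80, 129, 130, 160, 192], [12,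
  20, 66, 72, 96, 129, 144, 160], [3, 6, 9, 48, 68, 80, 136, 160], [3, 5, 10, 48, 68, 96, 136,
  144], [12, 24, 36, 65, 80, 130, 160, 192], [3, 5, 10, 20, 72, 96, 144, 160], [3, 5, 10, 20, 80,
  96, 136, 160], [10, 20, 66, 68, 96, 136, 144, 160], [3, 33, 66, 132, 136, 144, 160, 192], [6,
  24, 66, 72, 96, 132, 144, 160], [3, 5, 10, 20, 96, 96, 136, 144], [3, 5, 10, 20, 40, 96, 144,
  192], [12, 20, 40, 80, 129, 130, 160, 192], [3, 5, 10, 20, 40, 80, 160, 192]]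

def zL9 : List (List ℕ) := [
  [6, 8, 16, 33, 34, 68, 69, 128, 224], [5, 8, 16, 34, 36, 65, 70, 128, 224], [5, 6, 8, 16, 33,
  66, 100, 128, 224], [3, 4, 16, 34, 40, 64, 129, 152, 224], [2, 17, 24, 33, 36, 64, 84, 128,
  168], [2, 4, 33, 48, 65, 72, 128, 168, 208], [5, 6, 8, 16, 34, 68, 97, 128, 224], [3, 4, 10, 18,
  32, 64, 129, 168, 208], [3, 4, 8, 18, 34, 65, 128, 208, 224], [8, 16, 33, 34, 65, 68, 130, 132,
  224], [3, 12, 16, 33, 36, 66, 72, 128, 224], [5, 10, 16, 33, 34, 68, 72, 128, 224], [9, 18, 24,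
  28, 33, 34, 36, 64, 128], [9, 10, 18, 20, 32, 64, 129, 140, 144], [3, 10, 12, 16, 40, 65, 68,
  128, 224], [3, 9, 12, 18, 20, 32, 88, 128, 192], [5, 10, 32, 65, 66, 80, 132, 136, 144], [3, 12,
  32, 65, 68, 80, 130, 136, 144], [5, 10, 18, 33, 68, 72, 144, 160, 192], [5, 9, 18, 34, 68, 96,
  136, 144, 192], [5, 9, 18, 66, 68, 96, 136, 144, 160], [5, 10, 17, 66, 68, 96, 136, 144, 160],
  [6, 34, 40, 48, 65, 80, 132, 136, 192], [3, 12, 17, 66, 68, 96, 136, 144, 160], [6, 36, 40, 48,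
  65, 80, 130, 136, 192], [9, 18, 36, 65, 66, 68, 136, 144, 160], [10, 20, 34, 36, 72, 80, 129,
  160, 192], [3, 9, 20, 66, 68, 96, 136, 144, 160], [3, 20, 40, 65, 68, 72, 130, 144, 160], [10,
  20, 66, 68, 96, 129, 136, 144, 160], [3, 5, 24, 66, 72, 96, 132, 144, 160], [6, 34, 40, 48, 65,
  72, 132, 144, 192], [3, 5, 24, 66, 80, 96, 132, 136, 160], [6, 36, 40, 48, 65, 72, 130, 144,
  192], [6, 24, 34, 40, 68, 80, 129, 160, 192], [5, 10, 17, 34, 68, 72, 144, 160, 192], [5, 9, 18,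
  34, 68, 80, 136, 160, 192], [6, 9, 17, 66, 72, 96, 132, 144, 160], [3, 12, 48, 65, 68, 80, 130,
  136, 160], [6, 9, 17, 68, 72, 96, 130, 144, 160]]

def zL10 : List (List ℕ) := [
  [2, 5, 9, 24, 36, 49, 64, 84, 128, 168], [3, 4, 16, 34, 40, 64, 129, 138, 152, 224], [2, 4, 9,
  17, 48, 72, 97, 128, 168, 208], [2, 5, 9, 16, 32, 72, 84, 132, 168, 194], [2, 4, 9, 17, 48, 72,
  100, 128, 168, 208], [3, 4, 10, 18, 32, 64, 129, 152, 168, 208], [1, 2, 28, 36, 40, 68, 80, 136,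
  144, 224], [4, 9, 18, 40, 48, 64, 129, 130, 152, 224], [5, 10, 17, 24, 34, 36, 64, 76, 128,
  176], [5, 10, 18, 20, 33, 40, 64, 76, 128, 176], [4, 9, 18, 33, 48, 66, 72, 128, 152, 224], [4,
  9, 18, 34, 40, 65, 80, 128, 152, 224], [6, 9, 17, 20, 34, 40, 64, 76, 128, 176], [4, 10, 17, 33,
  40, 66, 80, 128, 152, 224], [3, 4, 8, 34, 48, 65, 80, 144, 161, 194], [3, 5, 8, 20, 34, 48, 68,
  82, 128, 224], [6, 8, 17, 20, 36, 65, 66, 112, 128, 224], [5, 6, 9, 18, 24, 32, 64, 132, 168,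
  208], [3, 5, 12, 18, 24, 32, 74, 84, 128, 192], [5, 10, 12, 16, 33, 34, 100, 104, 128, 192], [4,
  9, 18, 34, 40, 65, 80, 136, 144, 224], [9, 12, 18, 20, 34, 40, 65, 80, 128, 224], [8, 20, 33,
  48, 66, 80, 129, 130, 132, 224], [4, 9, 18, 33, 48, 66, 72, 136, 144, 224], [4, 10, 17, 33, 40,
  66, 80, 136, 144, 224], [9, 12, 18, 20, 33, 48, 66, 72, 128, 224], [10, 12, 17, 20, 33, 40, 66,
  80, 128, 224], [17, 24, 34, 36, 48, 65, 66, 132, 136, 192], [17, 18, 36, 40, 48, 65, 72, 130,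
  132, 192], [17, 18, 36, 40, 48, 65, 68, 130, 136, 192], [17, 20, 34, 40, 48, 65, 66, 132, 136,
  192]]

def zL11 : List (List ℕ) := [
  [3, 5, 8, 16, 32, 68, 82, 130, 164, 193, 200], [2, 4, 9, 17, 48, 72, 97, 100, 128, 168, 208],
  [1, 10, 20, 32, 70, 72, 80, 130, 132, 152, 224], [6, 10, 16, 32, 65, 72, 84, 129, 132, 168,
  194], [2, 12, 20, 33, 48, 65, 72, 100, 128, 168, 208], [5, 10, 18, 20, 33, 40, 64, 67, 128, 140,
  176], [6, 9, 17, 20, 34, 40, 64, 67, 128, 140, 176], [5, 10, 17, 24, 34, 36, 64, 67, 128, 140,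
  176], [1, 10, 20, 34, 48, 68, 72, 128, 134, 152, 224], [1, 10, 20, 36, 40, 66, 80, 128, 134,
  152, 224], [1, 12, 18, 34, 40, 68, 80, 128, 134, 152, 224], [1, 12, 18, 20, 32, 66, 72, 132,
  138, 208, 224], [3, 6, 12, 16, 32, 65, 72, 130, 152, 196, 224], [2, 12, 17, 24, 33, 36, 64, 148,
  168, 176, 192], [1, 10, 20, 24, 34, 36, 64, 134, 168, 176, 192], [5, 10, 17, 18, 28, 33, 40, 66,
  68, 128, 224], [2, 20, 36, 40, 65, 72, 80, 129, 132, 152, 224], [5, 10, 20, 24, 32, 66, 68, 129,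
  136, 208, 224], [1, 10, 20, 34, 48, 68, 72, 130, 132, 152, 224], [6, 12, 17, 18, 40, 48, 64,
  129, 132, 152, 224], [3, 5, 10, 20, 34, 48, 68, 72, 128, 152, 224], [2, 20, 40, 65, 76, 80, 96,
  129, 132, 136, 176], [6, 9, 17, 18, 28, 33, 36, 66, 72, 128, 224], [5, 10, 20, 24, 32, 65, 72,
  130, 132, 208, 224], [1, 10, 20, 36, 40, 66, 80, 130, 132, 152, 224], [5, 10, 17, 18, 28, 34,
  36, 65, 72, 128, 224], [6, 9, 20, 24, 32, 65, 68, 130, 136, 208, 224], [1, 12, 18, 34, 40, 68,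
  80, 130, 132, 152, 224], [3, 5, 10, 20, 36, 40, 66, 80, 128, 152, 224], [3, 5, 12, 18, 34, 40,
  68, 80, 128, 152, 224], [3, 5, 10, 20, 34, 48, 72, 80, 132, 136, 224], [3, 5, 10, 20, 40, 48,
  66, 80, 132, 136, 224], [3, 5, 10, 20, 36, 40, 66, 80, 136, 144, 224], [3, 5, 10, 20, 36, 40,
  72, 80, 130, 144, 224], [9, 18, 40, 48, 66, 68, 72, 129, 132, 144, 224], [10, 17, 40, 48, 65,
  68, 72, 130, 132, 144, 224], [3, 5, 10, 20, 40, 48, 68, 72, 130, 144, 224], [3, 5, 10, 20, 34,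
  48, 68, 72, 136, 144, 224]]

def zL12 : List (List ℕ) := [
  [4, 8, 18, 33, 52, 66, 81, 96, 129, 144, 162, 200], [1, 12, 18, 36, 42, 48, 66, 72, 84, 128,
  152, 224], [4, 8, 18, 34, 49, 65, 84, 96, 129, 144, 168, 194], [8, 18, 20, 25, 33, 36, 65, 66,
  112, 128, 162, 196], [1, 12, 20, 26, 34, 48, 66, 72, 100, 128, 168, 208], [1, 20, 24, 34, 40,
  66, 68, 112, 128, 146, 164, 200], [3, 5, 8, 16, 36, 66, 96, 129, 162, 168, 196, 208], [1, 12,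
  18, 24, 34, 36, 64, 138, 148, 168, 176, 192], [5, 10, 12, 17, 22, 40, 48, 64, 129, 130, 152,
  224], [5, 10, 17, 18, 28, 32, 65, 72, 130, 132, 208, 224], [5, 6, 9, 18, 33, 48, 66, 72, 100,
  128, 152, 224], [1, 18, 24, 34, 36, 72, 84, 96, 132, 144, 168, 194], [1, 18, 36, 40, 48, 66, 72,
  84, 130, 132, 152, 224], [6, 10, 17, 20, 32, 72, 80, 129, 130, 152, 196, 224], [9, 12, 17, 18,
  32, 68, 74, 80, 130, 136, 148, 224], [3, 5, 12, 20, 34, 48, 66, 72, 100, 128, 168, 208], [6, 9,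
  17, 18, 28, 32, 65, 68, 130, 136, 208, 224], [5, 6, 9, 18, 34, 40, 65, 80, 100, 128, 152, 224],
  [5, 10, 17, 18, 28, 32, 66, 68, 129, 136, 208, 224], [5, 6, 10, 17, 33, 40, 66, 80, 100, 128,
  152, 224], [5, 10, 28, 33, 34, 65, 72, 80, 130, 132, 144, 224], [3, 12, 33, 36, 48, 66, 72, 80,
  130, 132, 152, 224], [12, 18, 33, 34, 40, 65, 68, 80, 130, 132, 152, 224], [6, 9, 17, 18, 33,
  36, 66, 72, 132, 136, 208, 224], [5, 10, 17, 18, 36, 40, 65, 72, 130, 132, 208, 224], [6, 9, 17,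
  18, 33, 36, 68, 72, 130, 136, 208, 224], [6, 9, 28, 33, 34, 65, 68, 80, 130, 136, 144, 224], [5,
  10, 17, 18, 36, 40, 66, 68, 129, 136, 208, 224], [10, 20, 33, 34, 48, 65, 68, 72, 130, 132, 152,
  224], [17, 24, 34, 40, 52, 66, 68, 80, 129, 132, 160, 200], [12, 20, 33, 48, 66, 72, 96, 129,
  130, 132, 168, 208], [18, 24, 33, 40, 52, 65, 68, 80, 130, 132, 160, 200]]

def zL13 : List (List ℕ) := [
  [1, 7, 12, 18, 36, 42, 48, 66, 72, 84, 128, 152, 224], [1, 12, 18, 36, 42, 48, 66, 72, 84, 128,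
  134, 152, 224], [1, 7, 12, 20, 26, 34, 48, 66, 72, 100, 128, 168, 208], [1, 12, 20, 26, 34, 48,
  66, 72, 100, 128, 134, 168, 208], [1, 14, 20, 24, 34, 40, 66, 68, 112, 128, 146, 164, 200], [1,
  12, 18, 24, 34, 36, 64, 134, 138, 148, 168, 176, 192], [3, 5, 12, 18, 25, 32, 68, 74, 80, 130,
  136, 148, 224], [3, 6, 12, 20, 33, 48, 65, 72, 82, 100, 128, 168, 208], [6, 9, 12, 17, 26, 32,
  68, 80, 129, 130, 148, 200, 224], [5, 6, 9, 18, 28, 33, 48, 66, 72, 100, 128, 152, 224], [1, 10,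
  12, 20, 34, 56, 68, 82, 96, 130, 144, 164, 200], [9, 12, 17, 18, 32, 68, 74, 80, 130, 136, 148,
  193, 224], [1, 10, 12, 20, 36, 50, 66, 88, 96, 130, 144, 168, 196], [3, 5, 12, 18, 36, 42, 48,
  66, 72, 84, 128, 152, 224], [3, 5, 12, 20, 26, 34, 48, 66, 72, 100, 128, 168, 208], [5, 6, 10,
  17, 28, 33, 40, 66, 80, 100, 128, 152, 224], [5, 6, 9, 18, 28, 34, 40, 65, 80, 100, 128, 152,
  224], [10, 17, 28, 33, 36, 40, 66, 68, 80, 131, 136, 144, 224], [9, 18, 28, 33, 36, 48, 66, 68,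
  72, 129, 130, 152, 224], [5, 10, 28, 34, 36, 48, 65, 72, 80, 129, 130, 152, 224], [9, 20, 34,
  40, 48, 65, 70, 80, 129, 130, 132, 152, 224], [5, 9, 18, 24, 34, 36, 72, 84, 96, 132, 144, 168,
  194], [9, 20, 24, 34, 48, 66, 72, 100, 129, 130, 132, 168, 208], [9, 18, 36, 40, 48, 65, 70, 80,
  129, 130, 132, 152, 224], [5, 18, 34, 36, 40, 65, 72, 80, 129, 130, 148, 152, 224], [5, 10, 34,
  36, 48, 65, 72, 80, 129, 130, 148, 152, 224], [10, 17, 28, 33, 36, 40, 66, 68, 80, 129, 130,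
  152, 224], [9, 20, 24, 34, 40, 66, 80, 100, 129, 130, 132, 176, 200], [6, 9, 17, 20, 33, 34, 66,
  72, 132, 136, 176, 208, 224], [6, 9, 17, 18, 33, 36, 66, 72, 132, 136, 176, 208, 224], [6, 9,
  17, 20, 34, 40, 65, 66, 132, 136, 176, 208, 224], [9, 18, 28, 34, 36, 40, 65, 68, 80, 131, 136,
  144, 224], [20, 24, 34, 40, 65, 68, 82, 96, 129, 130, 144, 164, 200]]

def zL14 : List (List ℕ) := [
  [3, 5, 12, 18, 36, 42, 48, 66, 72, 84, 97, 128, 152, 224], [5, 6, 10, 17, 28, 32, 66, 73, 80,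
  129, 136, 146, 196, 224], [5, 6, 10, 18, 33, 44, 48, 65, 72, 84, 98, 128, 168, 208], [6, 9, 17,
  20, 34, 40, 67, 76, 80, 96, 131, 132, 136, 176], [10, 20, 36, 40, 49, 65, 70, 72, 80, 129, 130,
  132, 152, 224], [5, 10, 17, 24, 34, 36, 76, 80, 96, 131, 132, 136, 176, 194], [5, 10, 18, 20,
  33, 40, 67, 76, 80, 96, 131, 132, 136, 176], [10, 20, 24, 33, 48, 65, 70, 72, 100, 129, 130,
  132, 168, 208], [5, 18, 20, 24, 33, 40, 66, 76, 96, 129, 130, 176, 196, 200], [12, 18, 24, 33,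
  48, 65, 70, 72, 100, 129, 130, 132, 168, 208], [10, 20, 24, 33, 38, 48, 65, 70, 72, 129, 130,
  132, 168, 208], [5, 10, 18, 20, 33, 40, 76, 80, 96, 129, 130, 176, 196, 200], [12, 18, 24, 33,
  38, 48, 65, 70, 72, 129, 130, 132, 168, 208], [6, 10, 24, 36, 49, 65, 72, 84, 96, 129, 132, 144,
  168, 194], [12, 18, 34, 36, 56, 65, 68, 74, 80, 129, 130, 136, 148, 224], [5, 9, 18, 24, 34, 36,
  72, 84, 96, 132, 144, 168, 193, 194], [10, 20, 24, 33, 48, 65, 72, 98, 100, 129, 130, 132, 168,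
  208], [5, 10, 34, 36, 48, 65, 72, 80, 129, 130, 140, 148, 152, 224], [5, 10, 17, 24, 34, 36, 76,
  80, 96, 132, 136, 176, 193, 194], [10, 20, 24, 33, 40, 65, 80, 98, 100, 129, 130, 132, 176,
  200], [20, 24, 34, 40, 49, 65, 68, 82, 96, 129, 130, 144, 164, 200]]

theorem zStep0 : zStep 14 zL0 zL1 = true := by decide +kernel

theorem zStep1 : zStep 13 zL1 zL2 = true := by decide +kernel

theorem zStep2 : zStep 12 zL2 zL3 = true := by decide +kernel

theorem zStep3 : zStep 11 zL3 zL4 = true := by decide +kernel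

theorem zStep4 : zStep 10 zL4 zL5 = true := by decide +kernel

theorem zStep5 : zStep 9 zL5 zL6 = true := by decide +kernel

theorem zStep6 : zStep 8 zL6 zL7 = true := by decide +kernel

theorem zStep7 : zStep 7 zL7 zL8 = true := by decide +kernel

theorem zStep8 : zStep 6 zL8 zL9 = true := by decide +kernel

theorem zStep9 : zStep 5 zL9 zL10 = true := by decide +kernel

theorem zStep10 : zStep 4 zL10 zL11 = true := by decide +kernel

theorem zStep11 : zStep 3 zL11 zL12 = true := by decide +kernel

theorem zStep12 : zStep 2 zL12 zL13 = true := by decide +kernel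

theorem zStep13 : zStep 1 zL13 zL14 = true := by decide +kernel

theorem zFinal14 : zFinal zL14 = true := by decide +kernel

/-! ### Soundness of the computation -/

theorem zAll_iff {α : Type} (p : α → Bool) (l : List α) :
    zAll p l = true ↔ ∀ a ∈ l, p a = true := by
  induction l with
  | nil => simp [zAll]
  | cons a l ih =>
    have h : zAll p (a :: l) = cond (p a) (zAll p l) false := rfl
    rw [h]; cases hp : p a <;> simp [hp, ih]

theorem zAny_iff {α : Type} (p : α → Bool) (l : List α) :
    zAny p l = true ↔ ∃ a ∈ l, p a = true := by
  induction l with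
  | nil => simp [zAny]
  | cons a l ih =>
    have h : zAny p (a :: l) = cond (p a) true (zAny p l) := rfl
    rw [h]; cases hp : p a <;> simp [hp, ih]

theorem zCnt_eq (S : ℕ) (f : List ℕ) : zCnt S f = f.countP (fun c => zSub c S) := by
  induction f with
  | nil => rfl
  | cons a l ih =>
    have h : zCnt S (a :: l) = cond (zSub a S) (zCnt S l + 1) (zCnt S l) := rfl
    rw [h, List.countP_cons, ih]; cases hp : zSub a S <;> simp

theorem zSub_testBit {c S : ℕ} (h : zSub c S = true) (a : ℕ) (ha : c.testBit a = true) :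
    S.testBit a = true := by
  have h1 : c &&& S = c := Nat.eq_of_beq_eq_true h
  rw [← h1, Nat.testBit_and] at ha
  simp at ha
  exact ha.2

theorem zIns_perm (key : ℕ → ℕ) (a : ℕ) (l : List ℕ) : (zIns key a l).Perm (a :: l) := by
  induction l with
  | nil => exact List.Perm.refl _
  | cons b l ih =>
    have h : zIns key a (b :: l) =
      cond (Nat.ble (key a) (key b)) (a :: b :: l) (b :: zIns key a l) := rfl
    rw [h]
    cases Nat.ble (key a) (key b)
    · exact (ih.cons b).trans (List.Perm.swap a b l)
    · exact List.Perm.refl _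

theorem zSort_perm (key : ℕ → ℕ) (l : List ℕ) : (zSort key l).Perm l := by
  induction l with
  | nil => exact List.Perm.refl _
  | cons a l ih => exact (zIns_perm key a _).trans (ih.cons a)

theorem zMapR_eq (o f : List ℕ) : zMapR o f = f.map (fun c => zReorder c o) := by
  induction f with
  | nil => rfl
  | cons a l ih => rw [List.map_cons, ← ih]; rfl

theorem zTot_eq (f : List ℕ) : zTot f = (f.map zPc).sum := by
  induction f with
  | nil => rfl
  | cons a l ih => rw [List.map_cons, List.sum_cons, ← ih]; rfl

theorem zEq_iff (l m : List ℕ) : zEq l m = true → l = m := by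
  induction l generalizing m with
  | nil => cases m with
    | nil => simp
    | cons b m => intro h; exact absurd h (by change ¬ (false = true); simp)
  | cons a l ih => cases m with
    | nil => intro h; exact absurd h (by change ¬ (false = true); simp)
    | cons b m =>
      have h : zEq (a :: l) (b :: m) = cond (Nat.beq a b) (zEq l m) false := rfl
      rw [h]
      cases hb : Nat.beq a b
      · simp
      · intro h2
        rw [Nat.eq_of_beq_eq_true hb, ih m h2]

theorem zSat_mem (f K4 : List ℕ) (S : ℕ) (h : S ∈ zSat f K4) : S ∈ K4 ∧ 3 ≤ zCnt S f := by
  induction K4 with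
  | nil => exact absurd h (by change ¬ (S ∈ []); simp)
  | cons T l ih =>
    have h1 : zSat f (T :: l) = cond (Nat.ble 3 (zCnt T f)) (T :: zSat f l) (zSat f l) := rfl
    rw [h1] at h
    cases hb : Nat.ble 3 (zCnt T f)
    · rw [hb] at h
      have := ih h
      exact ⟨List.mem_cons_of_mem _ this.1, this.2⟩
    · rw [hb] at h
      rcases List.mem_cons.1 h with h | h
      · subst h
        exact ⟨by simp, Nat.le_of_ble_eq_true hb⟩
      · have := ih h
        exact ⟨List.mem_cons_of_mem _ this.1, this.2⟩

/-- The mask of the set `s` with respect to the enumeration `l`. -/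
def zEnc (s : Finset (Fin 8)) (l : List (Fin 8)) : ℕ :=
  l.foldr (fun i acc => (if i ∈ s then 1 else 0) + 2 * acc) 0

theorem zEnc_cons (s : Finset (Fin 8)) (i : Fin 8) (l : List (Fin 8)) :
    zEnc s (i :: l) = (if i ∈ s then 1 else 0) + 2 * zEnc s l := rfl

theorem zEnc_bit (s : Finset (Fin 8)) (l : List (Fin 8)) (a : ℕ) (ha : a < l.length) :
    (zEnc s l >>> a) % 2 = if l.getD a 0 ∈ s then 1 else 0 := by
  induction l generalizing a with
  | nil => simp at ha
  | cons i l ih =>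
    rw [zEnc_cons]
    cases a with
    | zero => simp only [Nat.shiftRight_zero, List.getD_cons_zero]; split_ifs <;> omega
    | succ a =>
      have h1 : ((if i ∈ s then 1 else 0) + 2 * zEnc s l) >>> (a + 1) = zEnc s l >>> a := by
        rw [Nat.add_comm a 1, Nat.shiftRight_add]
        congr 1
        rw [Nat.shiftRight_one]
        split_ifs <;> omega
      rw [h1, List.getD_cons_succ]
      exact ih a (by simpa using ha)

theorem zEnc_testBit (s : Finset (Fin 8)) (l : List (Fin 8)) (a : ℕ) (ha : a < l.length) :
    (zEnc s l).testBit a = decide (l.getD a 0 ∈ s) := by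
  have h := zEnc_bit s l a ha
  rw [Nat.testBit_eq_decide_div_mod_eq, ← Nat.shiftRight_eq_div_pow, h]
  split_ifs with h1 <;> simp only [h1]

theorem zEnc_lt (s : Finset (Fin 8)) (l : List (Fin 8)) : zEnc s l < 2 ^ l.length := by
  induction l with
  | nil => simp [zEnc]
  | cons i l ih =>
    rw [zEnc_cons, List.length_cons, pow_succ]
    split_ifs <;> omega

theorem zReorder_enc (s : Finset (Fin 8)) (l : List (Fin 8)) (o : List ℕ)
    (ho : ∀ a ∈ o, a < l.length) :
    zReorder (zEnc s l) o = zEnc s (o.map (fun a => l.getD a 0)) := by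
  induction o with
  | nil => rfl
  | cons a o ih =>
    have h : zReorder (zEnc s l) (a :: o) =
      (zEnc s l >>> a) % 2 + 2 * zReorder (zEnc s l) o := rfl
    rw [h, ih (fun b hb => ho b (List.mem_cons_of_mem _ hb)), zEnc_bit s l a (ho a (by simp)),
      List.map_cons, zEnc_cons]

theorem zPc_bits' : ∀ a b c d e f g h : Fin 2,
    zPc (a.1 + 2 * (b.1 + 2 * (c.1 + 2 * (d.1 + 2 * (e.1 + 2 * (f.1 + 2 * (g.1 + 2 *
      (h.1 + 2 * 0)))))))) =
      a.1 + (b.1 + (c.1 + (d.1 + (e.1 + (f.1 + (g.1 + (h.1 + 0))))))) := by decide +kernel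

theorem zPc_bits (a : ℕ) (ha : a < 2) (b : ℕ) (hb : b < 2) (c : ℕ) (hc : c < 2) (d : ℕ)
    (hd : d < 2) (e : ℕ) (he : e < 2) (f : ℕ) (hf : f < 2) (g : ℕ) (hg : g < 2) (h : ℕ)
    (hh : h < 2) :
    zPc (a + 2 * (b + 2 * (c + 2 * (d + 2 * (e + 2 * (f + 2 * (g + 2 * (h + 2 * 0)))))))) =
      a + (b + (c + (d + (e + (f + (g + (h + 0))))))) :=
  zPc_bits' ⟨a, ha⟩ ⟨b, hb⟩ ⟨c, hc⟩ ⟨d, hd⟩ ⟨e, he⟩ ⟨f, hf⟩ ⟨g, hg⟩ ⟨h, hh⟩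

theorem zPc_enc (s : Finset (Fin 8)) (l : List (Fin 8)) (hl : l.Perm (List.finRange 8)) :
    zPc (zEnc s l) = s.card := by
  have hc : s.card = (l.map (fun i => if i ∈ s then 1 else 0)).sum := by
    rw [(hl.map _).sum_eq, ← List.ofFn_eq_map, List.sum_ofFn]
    simp
  have hlen : l.length = 8 := by rw [hl.length_eq]; simp
  rw [hc]
  match l, hlen with
  | [a, b, c, d, e, f, g, h], _ =>
    have hx : ∀ i, (if i ∈ s then 1 else 0 : ℕ) < 2 := by intro i; split_ifs <;> omega
    have := zPc_bits _ (hx a) _ (hx b) _ (hx c) _ (hx d) _ (hx e) _ (hx f) _ (hx g) _ (hx h)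
    simpa only [zEnc, List.foldr, List.map_cons, List.map_nil, List.sum_cons, List.sum_nil] using this

/-- The set with mask `S`. -/
def zDec (S : ℕ) (l : List (Fin 8)) : Finset (Fin 8) :=
  Finset.univ.filter (fun i => S.testBit (l.idxOf i) = true)

theorem zSub_dec (s : Finset (Fin 8)) (l : List (Fin 8)) (hl : l.Perm (List.finRange 8))
    (S : ℕ) (h : zSub (zEnc s l) S = true) : s ⊆ zDec S l := by
  intro i hi
  have hm : i ∈ l := hl.mem_iff.2 (List.mem_finRange i)
  have hlt : l.idxOf i < l.length := List.idxOf_lt_length_iff.2 hm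
  simp only [zDec, Finset.mem_filter, Finset.mem_univ, true_and]
  apply zSub_testBit h
  rw [zEnc_testBit _ _ _ hlt]
  rw [List.getD_eq_getElem _ _ hlt, List.getElem_idxOf hlt]
  simpa using hi

theorem zDec_card (l : List (Fin 8)) (hl : l.Perm (List.finRange 8))
    (S : ℕ) (hS : S < 256) : (zDec S l).card = zPc S := by
  have hlen : l.length = 8 := by rw [hl.length_eq]; simp
  have hnd : l.Nodup := hl.nodup_iff.2 (List.nodup_finRange 8)
  rw [← zPc_enc _ l hl]
  congr 1
  apply Nat.eq_of_testBit_eq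
  intro a
  by_cases ha : a < l.length
  · rw [zEnc_testBit _ _ _ ha]
    rw [List.getD_eq_getElem _ _ ha]
    simp [zDec, hnd.idxOf_getElem a ha]
  · have h1 : ∀ x < 256, x.testBit a = false := fun x hx => Nat.testBit_lt_two_pow
      (lt_of_lt_of_le hx (by
        calc 256 = 2 ^ 8 := by norm_num
        _ ≤ 2 ^ a := Nat.pow_le_pow_right (by norm_num) (by omega)))
    rw [h1 S hS, h1]
    have := zEnc_lt (zDec S l) l
    rw [hlen] at this
    simpa using this

theorem zE4_spec : ∀ S ∈ zE4, S < 256 ∧ zPc S = 4 := by decide +kernel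
theorem zE5_spec : ∀ S ∈ zE5, S < 256 ∧ zPc S = 5 := by decide +kernel
theorem zE0_spec : ∀ S < 256, zPc S = 0 → S ∈ zE0 := by decide +kernel
theorem zE1_spec : ∀ S < 256, zPc S = 1 → S ∈ zE1 := by decide +kernel
theorem zE2_spec : ∀ S < 256, zPc S = 2 → S ∈ zE2 := by decide +kernel
theorem zE3_spec : ∀ S < 256, zPc S = 3 → S ∈ zE3 := by decide +kernel

theorem zNorm_enc (l : List (Fin 8)) (hl : l.Perm (List.finRange 8)) (f : List ℕ)
    (zs : List (Finset (Fin 8))) (hf : f.Perm (zs.map (fun s => zEnc s l))) :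
    ∃ l' : List (Fin 8), l'.Perm (List.finRange 8) ∧
      (zNorm f).Perm (zs.map (fun s => zEnc s l')) := by
  have hlen : l.length = 8 := by rw [hl.length_eq]; simp
  have ho : (zOrd f).Perm [0, 1, 2, 3, 4, 5, 6, 7] := zSort_perm _ _
  refine ⟨(zOrd f).map (fun a => l.getD a 0), ?_, ?_⟩
  · refine (ho.map _).trans ?_
    refine List.Perm.trans (List.Perm.of_eq ?_) hl
    match l, hlen with
    | [a, b, c, d, e, f, g, h], _ => rfl
  · refine (zSort_perm _ _).trans ?_
    rw [zMapR_eq]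
    refine (hf.map _).trans (List.Perm.of_eq ?_)
    rw [List.map_map]
    apply List.map_congr_left
    intro s _
    apply zReorder_enc
    intro a ha
    have := ho.mem_iff.1 ha
    simp at this
    omega

/-- The invariant of the search: some member of `L` is the family of the masks of the sets
`C y`, `y ∈ zs`. -/
def zInv (C : Fin 14 → Finset (Fin 8)) (zs : List (Fin 14)) (L : List (List ℕ)) : Prop :=
  ∃ l : List (Fin 8), l.Perm (List.finRange 8) ∧ ∃ f ∈ L,
    f.Perm (zs.map (fun y => zEnc (C y) l))

theorem zBr_spec (r : ℕ) (f st : List ℕ) (L : List (List ℕ)) (p : ℕ) (ms : List ℕ) (s : ℕ)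
    (h : zBr r f st L p ms = true) (hs : s ∈ ms) (h1 : ∀ c ∈ f, zPc c ≤ p)
    (h2 : zTot f + r * p ≤ 32) (h3 : ∀ S ∈ st, zSub s S = false) : zNorm (s :: f) ∈ L := by
  unfold zBr at h
  have e1 : zAll (fun c => Nat.ble (zPc c) p) f = true :=
    (zAll_iff _ _).2 (fun a ha => Nat.ble_eq_true_of_le (h1 a ha))
  have e2 : Nat.ble (Nat.add (zTot f) (Nat.mul r p)) 32 = true := Nat.ble_eq_true_of_le h2
  rw [e1, e2] at h
  have h4 := (zAll_iff _ _).1 h s hs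
  have e3 : zAny (zSub s) st = false := by
    rw [← Bool.not_eq_true, zAny_iff]
    rintro ⟨S, hS, hS'⟩
    rw [h3 S hS] at hS'
    exact absurd hS' (by simp)
  simp only [e3, cond_false] at h4
  obtain ⟨g, hg, hg'⟩ := (zAny_iff _ _).1 h4
  rw [zEq_iff _ _ hg']
  exact hg

theorem zFour (C : Fin 14 → Finset (Fin 8)) (K : Fin 14 → Prop) (n : ℕ)
    (h4 : ∀ S : Finset (Fin 8), S.card = n → ∀ B : Finset (Fin 14), B.card = 4 →
      ¬ ∀ y ∈ B, K y ∧ C y ⊆ S) (l : List (Fin 8)) (hl : l.Perm (List.finRange 8))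
    (zs : List (Fin 14)) (y : Fin 14) (hnd : (y :: zs).Nodup) (hK : ∀ z ∈ y :: zs, K z)
    (S : ℕ) (hS : S < 256 ∧ zPc S = n)
    (hc : 3 ≤ zCnt S (zs.map (fun y => zEnc (C y) l))) (hy : zSub (zEnc (C y) l) S = true) :
    False := by
  set q : Fin 14 → Bool := fun y => zSub (zEnc (C y) l) S with hq
  have h1 : 3 ≤ zs.countP q := by
    rw [zCnt_eq, List.countP_map] at hc
    exact hc
  have h2 : 4 ≤ ((y :: zs).filter q).toFinset.card := by
    rw [List.toFinset_card_of_nodup (hnd.filter _), ← List.countP_eq_length_filter,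
      List.countP_cons]
    have : q y = true := hy
    simp [this]
    omega
  obtain ⟨B, hB, hB4⟩ := Finset.exists_subset_card_eq h2
  refine h4 (zDec S l) (by rw [zDec_card l hl S hS.1, hS.2]) B hB4 ?_
  intro z hz
  have hz' := hB hz
  rw [List.mem_toFinset, List.mem_filter] at hz'
  exact ⟨hK z hz'.1, zSub_dec _ l hl S hz'.2⟩

theorem zInv_step (C : Fin 14 → Finset (Fin 8))
    (h4 : ∀ S : Finset (Fin 8), S.card = 4 → ∀ B : Finset (Fin 14), B.card = 4 →
      ¬ ∀ y ∈ B, True ∧ C y ⊆ S)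
    (zs : List (Fin 14)) (y : Fin 14) (r : ℕ) (L L' : List (List ℕ))
    (hst : zStep r L L' = true) (hi : zInv C zs L)
    (hnd : (y :: zs).Nodup) (hle : ∀ z ∈ zs, (C z).card ≤ (C y).card)
    (hsum : (zs.map (fun z => (C z).card)).sum + r * (C y).card ≤ 32) :
    zInv C (y :: zs) L' := by
  obtain ⟨l, hl, f, hf, hp⟩ := hi
  have hlen : l.length = 8 := by rw [hl.length_eq]; simp
  have hF := (zAll_iff _ _).1 hst f hf
  have htot : zTot f = (zs.map (fun z => (C z).card)).sum := by
    rw [zTot_eq, (hp.map zPc).sum_eq, List.map_map]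
    congr 1
    apply List.map_congr_left
    intro z _
    exact zPc_enc _ l hl
  have hpc : zPc (zEnc (C y) l) = (C y).card := zPc_enc _ l hl
  have hlt : zEnc (C y) l < 256 := by
    have := zEnc_lt (C y) l
    rw [hlen] at this
    simpa using this
  have hall : ∀ c ∈ f, zPc c ≤ (C y).card := by
    intro c hc
    obtain ⟨z, hz, rfl⟩ := List.mem_map.1 (hp.mem_iff.1 hc)
    rw [zPc_enc _ l hl]
    exact hle z hz
  have hsat : ∀ S ∈ zSat f zE4, zSub (zEnc (C y) l) S = false := by
    intro S hS
    obtain ⟨hS4, hS3⟩ := zSat_mem _ _ _ hS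
    rw [← Bool.not_eq_true]
    intro hsub
    refine zFour C (fun _ => True) 4 h4 l hl zs y hnd (fun _ _ => trivial) S (zE4_spec S hS4) ?_ hsub
    rw [zCnt_eq] at hS3 ⊢
    rwa [← hp.countP_eq]
  suffices hmem : zNorm (zEnc (C y) l :: f) ∈ L' by
    obtain ⟨l', hl', hn⟩ := zNorm_enc l hl (zEnc (C y) l :: f) ((y :: zs).map C) (by
      rw [List.map_map]
      exact hp.cons _)
    refine ⟨l', hl', _, hmem, ?_⟩
    rw [List.map_map] at hn
    exact hn
  have hsum' : zTot f + r * (C y).card ≤ 32 := by rw [htot]; exact hsum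
  simp only [zStepF, Bool.and_eq_true] at hF
  obtain ⟨b33, b0, b1, b2, b3⟩ := hF
  have b33' : 33 ≤ zTot f + r * 4 := Nat.le_of_ble_eq_true b33
  have hcard : (C y).card < 4 := by
    by_contra hcon
    have : r * 4 ≤ r * (C y).card := Nat.mul_le_mul_left r (by omega)
    omega
  generalize hpe : (C y).card = p at *
  interval_cases p
  · exact zBr_spec _ _ _ _ _ _ _ b0 (zE0_spec _ hlt hpc) hall hsum' hsat
  · exact zBr_spec _ _ _ _ _ _ _ b1 (zE1_spec _ hlt hpc) hall hsum' hsat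
  · exact zBr_spec _ _ _ _ _ _ _ b2 (zE2_spec _ hlt hpc) hall hsum' hsat
  · exact zBr_spec _ _ _ _ _ _ _ b3 (zE3_spec _ hlt hpc) hall hsum' hsat

theorem zFin_sound (C : Fin 14 → Finset (Fin 8)) (K : Fin 14 → Prop)
    (h5 : ∀ S : Finset (Fin 8), S.card = 5 → ∀ B : Finset (Fin 14), B.card = 4 →
      ¬ ∀ y ∈ B, K y ∧ C y ⊆ S)
    (l : List (Fin 8)) (hl : l.Perm (List.finRange 8)) (zs : List (Fin 14)) :
    ∀ (kept : List (Fin 14)) (d : ℕ), (kept ++ zs).Nodup → (∀ y ∈ kept, K y) →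
      (∀ B : Finset (Fin 14), (∀ y ∈ B, y ∈ zs ∧ ¬ K y) → B.card ≤ d) →
      zFin (zs.map (fun y => zEnc (C y) l)) (kept.map (fun y => zEnc (C y) l)) d = true →
      False := by
  induction zs with
  | nil =>
    intro kept d _ _ _ h
    exact absurd h (by change ¬ (false = true); simp)
  | cons y zs ih =>
    intro kept d hnd hk hB h
    have hperm : (kept ++ y :: zs).Perm (y :: kept ++ zs) := List.perm_middle
    have hnd' : (y :: kept ++ zs).Nodup := hperm.nodup_iff.1 hnd
    have hyz : y ∉ zs := by
      intro hy
      exact (List.nodup_cons.1 hnd').1 (List.mem_append_right _ hy)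
    have h' : ((Nat.rec true (fun d _ => zFin (zs.map (fun y => zEnc (C y) l))
          (kept.map (fun y => zEnc (C y) l)) d) d : Bool).and
        (cond (zAny (fun S => cond (zSub (zEnc (C y) l) S)
          (Nat.ble 3 (zCnt S (kept.map (fun y => zEnc (C y) l)))) false) zE5) true
        (zFin (zs.map (fun y => zEnc (C y) l)) ((y :: kept).map (fun y => zEnc (C y) l)) d)))
        = true := h
    rw [Bool.and_eq_true] at h'
    obtain ⟨ha, hb⟩ := h'
    by_cases hK : K y
    · cases hany : zAny (fun S => cond (zSub (zEnc (C y) l) S)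
          (Nat.ble 3 (zCnt S (kept.map (fun y => zEnc (C y) l)))) false) zE5
      · rw [hany] at hb
        refine ih (y :: kept) d hnd' ?_ ?_ hb
        · intro z hz
          rcases List.mem_cons.1 hz with rfl | hz
          · exact hK
          · exact hk z hz
        · intro B hB'
          exact hB B (fun z hz => ⟨List.mem_cons_of_mem _ (hB' z hz).1, (hB' z hz).2⟩)
      · obtain ⟨S, hS, hS'⟩ := (zAny_iff _ _).1 hany
        cases hsub : zSub (zEnc (C y) l) S
        · simp [hsub] at hS'
        · rw [hsub] at hS'
          refine zFour C K 5 h5 l hl kept y ?_ ?_ S (zE5_spec S hS)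
            (Nat.le_of_ble_eq_true hS') hsub
          · exact hnd'.sublist (List.sublist_append_left _ _)
          · intro z hz
            rcases List.mem_cons.1 hz with rfl | hz
            · exact hK
            · exact hk z hz
    · cases d with
      | zero =>
        have := hB {y} (by intro z hz; rw [Finset.mem_singleton] at hz; subst hz; simp [hK])
        simp at this
      | succ d =>
        refine ih kept d ?_ hk ?_ ha
        · exact hnd.sublist (List.Sublist.append_left (List.sublist_cons_self _ _) _)
        · intro B hB'
          have hyB : y ∉ B := fun hy => hyz (hB' y hy).1
          have := hB (insert y B) (by
            intro z hz
            rcases Finset.mem_insert.1 hz with rfl | hz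
            · exact ⟨by simp, hK⟩
            · exact ⟨List.mem_cons_of_mem _ (hB' z hz).1, (hB' z hz).2⟩)
          rw [Finset.card_insert_of_notMem hyB] at this
          omega

theorem zFinal_sound (C : Fin 14 → Finset (Fin 8)) (K : Fin 14 → Prop)
    (h5 : ∀ S : Finset (Fin 8), S.card = 5 → ∀ B : Finset (Fin 14), B.card = 4 →
      ¬ ∀ y ∈ B, K y ∧ C y ⊆ S)
    (zs : List (Fin 14)) (hnd : zs.Nodup) (L : List (List ℕ)) (hL : zFinal L = true)
    (hi : zInv C zs L)
    (hs : (zs.map (fun z => (C z).card)).sum ≤ 31 ∨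
      ∀ B : Finset (Fin 14), (∀ y ∈ B, ¬ K y) → B.card ≤ 5) : False := by
  obtain ⟨l, hl, f, hf, hp⟩ := hi
  have hF := (zAll_iff _ _).1 hL f hf
  rw [Bool.and_eq_true] at hF
  obtain ⟨ha, hb⟩ := hF
  rcases hs with hs | hs
  · have htot : zTot f = (zs.map (fun z => (C z).card)).sum := by
      rw [zTot_eq, (hp.map zPc).sum_eq, List.map_map]
      congr 1
      apply List.map_congr_left
      intro z _
      exact zPc_enc _ l hl
    have := Nat.le_of_ble_eq_true ha
    omega
  · obtain ⟨zs', hz, hz'⟩ : ∃ zs' : List (Fin 14), zs'.Perm zs ∧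
        f = zs'.map (fun y => zEnc (C y) l) := by
      have h := congrFun (congrFun (List.eq_map_comp_perm (fun y => zEnc (C y) l)) f) zs
      obtain ⟨zs', h1, h2⟩ := h.mpr hp
      exact ⟨zs', h2, h1⟩
    rw [hz'] at hb
    exact zFin_sound C K h5 l hl zs' [] 5 (by simpa using hz.nodup_iff.2 hnd) (by simp)
      (fun B hB => hs B (fun y hy => (hB y hy).2)) hb

set_option maxHeartbeats 4000000 in
theorem zCore (C : Fin 14 → Finset (Fin 8)) (K : Fin 14 → Prop)
    (hm : Monotone (fun y => (C y).card))
    (h4 : ∀ S : Finset (Fin 8), S.card = 4 → ∀ B : Finset (Fin 14), B.card = 4 →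
      ¬ ∀ y ∈ B, True ∧ C y ⊆ S)
    (h5 : ∀ S : Finset (Fin 8), S.card = 5 → ∀ B : Finset (Fin 14), B.card = 4 →
      ¬ ∀ y ∈ B, K y ∧ C y ⊆ S)
    (hsum : ∑ y, (C y).card ≤ 32)
    (hs : ∑ y, (C y).card ≤ 31 ∨ ∀ B : Finset (Fin 14), (∀ y ∈ B, ¬ K y) → B.card ≤ 5) :
    False := by
  have hmm : ∀ a b : Fin 14, a ≤ b → (C a).card ≤ (C b).card := fun a b h => hm h
  have m0 := hmm 0 1 (by decide)
  have m1 := hmm 1 2 (by decide)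
  have m2 := hmm 2 3 (by decide)
  have m3 := hmm 3 4 (by decide)
  have m4 := hmm 4 5 (by decide)
  have m5 := hmm 5 6 (by decide)
  have m6 := hmm 6 7 (by decide)
  have m7 := hmm 7 8 (by decide)
  have m8 := hmm 8 9 (by decide)
  have m9 := hmm 9 10 (by decide)
  have m10 := hmm 10 11 (by decide)
  have m11 := hmm 11 12 (by decide)
  have m12 := hmm 12 13 (by decide)
  have hle : ∀ (zs : List (Fin 14)) (y : Fin 14), (∀ z ∈ zs, z ≤ y) →
    ∀ z ∈ zs, (C z).card ≤ (C y).card := fun zs y h z hz => hm (h z hz)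
  have hS : ∑ y, (C y).card = (([13, 12, 11, 10, 9, 8, 7, 6, 5, 4, 3, 2, 1, 0] :
      List (Fin 14)).map (fun z => (C z).card)).sum := by
    rw [← List.sum_toFinset _ (by decide)]
    exact Finset.sum_congr (by decide) (fun _ _ => rfl)
  rw [hS] at hsum hs
  have i0 : zInv C [] zL0 := ⟨List.finRange 8, List.Perm.refl _, [], by simp [zL0], by simp⟩
  simp only [List.map_cons, List.map_nil, List.sum_cons, List.sum_nil] at hsum
  have i1 : zInv C [0] zL1 := zInv_step C h4 _ 0 14 zL0 zL1
    zStep0 i0 (by decide) (hle _ _ (by decide)) (by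
    simp only [List.map_cons, List.map_nil, List.sum_cons, List.sum_nil]; omega)
  have i2 : zInv C [1, 0] zL2 := zInv_step C h4 _ 1 13 zL1 zL2
    zStep1 i1 (by decide) (hle _ _ (by decide)) (by
    simp only [List.map_cons, List.map_nil, List.sum_cons, List.sum_nil]; omega)
  have i3 : zInv C [2, 1, 0] zL3 := zInv_step C h4 _ 2 12 zL2 zL3
    zStep2 i2 (by decide) (hle _ _ (by decide)) (by
    simp only [List.map_cons, List.map_nil, List.sum_cons, List.sum_nil]; omega)
  have i4 : zInv C [3, 2, 1, 0] zL4 := zInv_step C h4 _ 3 11 zL3 zL4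
    zStep3 i3 (by decide) (hle _ _ (by decide)) (by
    simp only [List.map_cons, List.map_nil, List.sum_cons, List.sum_nil]; omega)
  have i5 : zInv C [4, 3, 2, 1, 0] zL5 := zInv_step C h4 _ 4 10 zL4 zL5
    zStep4 i4 (by decide) (hle _ _ (by decide)) (by
    simp only [List.map_cons, List.map_nil, List.sum_cons, List.sum_nil]; omega)
  have i6 : zInv C [5, 4, 3, 2, 1, 0] zL6 := zInv_step C h4 _ 5 9 zL5 zL6
    zStep5 i5 (by decide) (hle _ _ (by decide)) (by
    simp only [List.map_cons, List.map_nil, List.sum_cons, List.sum_nil]; omega)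
  have i7 : zInv C [6, 5, 4, 3, 2, 1, 0] zL7 := zInv_step C h4 _ 6 8 zL6 zL7
    zStep6 i6 (by decide) (hle _ _ (by decide)) (by
    simp only [List.map_cons, List.map_nil, List.sum_cons, List.sum_nil]; omega)
  have i8 : zInv C [7, 6, 5, 4, 3, 2, 1, 0] zL8 := zInv_step C h4 _ 7 7 zL7 zL8
    zStep7 i7 (by decide) (hle _ _ (by decide)) (by
    simp only [List.map_cons, List.map_nil, List.sum_cons, List.sum_nil]; omega)
  have i9 : zInv C [8, 7, 6, 5, 4, 3, 2, 1, 0] zL9 := zInv_step C h4 _ 8 6 zL8 zL9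
    zStep8 i8 (by decide) (hle _ _ (by decide)) (by
    simp only [List.map_cons, List.map_nil, List.sum_cons, List.sum_nil]; omega)
  have i10 : zInv C [9, 8, 7, 6, 5, 4, 3, 2, 1, 0] zL10 := zInv_step C h4 _ 9 5 zL9 zL10
    zStep9 i9 (by decide) (hle _ _ (by decide)) (by
    simp only [List.map_cons, List.map_nil, List.sum_cons, List.sum_nil]; omega)
  have i11 : zInv C [10, 9, 8, 7, 6, 5, 4, 3, 2, 1, 0] zL11 := zInv_step C h4 _ 10 4 zL10 zL11
    zStep10 i10 (by decide) (hle _ _ (by decide)) (by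
    simp only [List.map_cons, List.map_nil, List.sum_cons, List.sum_nil]; omega)
  have i12 : zInv C [11, 10, 9, 8, 7, 6, 5, 4, 3, 2, 1, 0] zL12 := zInv_step C h4 _ 11 3 zL11 zL12
    zStep11 i11 (by decide) (hle _ _ (by decide)) (by
    simp only [List.map_cons, List.map_nil, List.sum_cons, List.sum_nil]; omega)
  have i13 : zInv C [12, 11, 10, 9, 8, 7, 6, 5, 4, 3, 2, 1, 0] zL13 := zInv_step C h4 _ 12 2 zL12 zL13
    zStep12 i12 (by decide) (hle _ _ (by decide)) (by
    simp only [List.map_cons, List.map_nil, List.sum_cons, List.sum_nil]; omega)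
  have i14 : zInv C [13, 12, 11, 10, 9, 8, 7, 6, 5, 4, 3, 2, 1, 0] zL14 := zInv_step C h4 _ 13 1 zL13 zL14
    zStep13 i13 (by decide) (hle _ _ (by decide)) (by
    simp only [List.map_cons, List.map_nil, List.sum_cons, List.sum_nil]; omega)
  exact zFinal_sound C K h5 _ (by decide) zL14 zFinal14 i14 hs

theorem zCore' (C : Fin 14 → Finset (Fin 8)) (K : Fin 14 → Prop)
    (h4 : ∀ S : Finset (Fin 8), S.card = 4 → ∀ B : Finset (Fin 14), B.card = 4 →
      ¬ ∀ y ∈ B, C y ⊆ S)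
    (h5 : ∀ S : Finset (Fin 8), S.card = 5 → ∀ B : Finset (Fin 14), B.card = 4 →
      ¬ ∀ y ∈ B, K y ∧ C y ⊆ S)
    (hsum : ∑ y, (C y).card ≤ 32)
    (hs : ∑ y, (C y).card ≤ 31 ∨ ∀ B : Finset (Fin 14), (∀ y ∈ B, ¬ K y) → B.card ≤ 5) :
    False := by
  set e : Equiv.Perm (Fin 14) := Tuple.sort (fun y => (C y).card) with he
  have hS : ∑ y, (C (e y)).card = ∑ y, (C y).card := Equiv.sum_comp e (fun y => (C y).card)
  refine zCore (fun y => C (e y)) (fun y => K (e y))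
    (Tuple.monotone_sort (fun y => (C y).card)) ?_ ?_ (by rw [hS]; exact hsum) ?_
  · intro S hS B hB h
    refine h4 S hS (B.map e.toEmbedding) (by rw [Finset.card_map, hB]) ?_
    intro y hy
    obtain ⟨z, hz, rfl⟩ := Finset.mem_map.1 hy
    exact (h z hz).2
  · intro S hS B hB h
    refine h5 S hS (B.map e.toEmbedding) (by rw [Finset.card_map, hB]) ?_
    intro y hy
    obtain ⟨z, hz, rfl⟩ := Finset.mem_map.1 hy
    exact h z hz
  · rw [hS]
    refine hs.imp_right ?_
    intro h B hB
    rw [← Finset.card_map e.toEmbedding]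
    apply h
    intro y hy
    obtain ⟨z, hz, rfl⟩ := Finset.mem_map.1 hy
    exact hB z hz

theorem zPart2 (G : Finset (Fin 9 × Fin 14)) (hG : ¬ ContainsK 9 14 4 4 G) : G.card ≤ 88 := by
  by_contra hcon
  obtain ⟨H, hHG, hH⟩ := Finset.exists_subset_card_eq (show 89 ≤ G.card by omega)
  have hfree : ∀ (R : Finset (Fin 9)) (B : Finset (Fin 14)), R.card = 4 → B.card = 4 →
      ¬ ∀ x ∈ R, ∀ y ∈ B, (x, y) ∈ H := fun R B hR hB h =>
    hG ⟨R, B, hR, hB, fun x hx y hy => hHG (h x hx y hy)⟩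
  set I : Fin 9 → Fin 14 → ℕ := fun x y => if (x, y) ∈ H then 1 else 0 with hI
  have htot : ∑ x, ∑ y, I x y = 89 := by
    rw [← hH, ← Fintype.sum_prod_type']
    simp [hI]
  obtain ⟨A, hA⟩ : ∃ A, ∑ y, I A y ≤ 9 := by
    by_contra hno
    push Not at hno
    have : ∑ x : Fin 9, 10 ≤ ∑ x, ∑ y, I x y := Finset.sum_le_sum (fun x _ => hno x)
    simp at this
    omega
  set C : Fin 14 → Finset (Fin 8) := fun y =>
    Finset.univ.filter (fun i => (A.succAbove i, y) ∉ H) with hC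
  have hCy : ∀ y, (C y).card + ∑ i, I (A.succAbove i) y = 8 := by
    intro y
    have h1 : ∑ i, I (A.succAbove i) y =
        (Finset.univ.filter (fun i => (A.succAbove i, y) ∈ H)).card := by
      simp [hI]
    have h2 := Finset.card_filter_add_card_filter_not (s := (Finset.univ : Finset (Fin 8)))
      (fun i => (A.succAbove i, y) ∈ H)
    rw [Finset.card_univ, Fintype.card_fin] at h2
    rw [h1]
    simp only [hC]
    omega
  have hCsum : ∑ y, (C y).card = 23 + ∑ y, I A y := by
    have h1 : ∑ y, ((C y).card + ∑ i, I (A.succAbove i) y) = 112 := by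
      rw [Finset.sum_congr rfl (fun y _ => hCy y)]
      simp
    rw [Finset.sum_add_distrib, Finset.sum_comm] at h1
    rw [Fin.sum_univ_succAbove _ A] at htot
    omega
  -- membership in the complement sets
  have hmem : ∀ (S : Finset (Fin 8)) (y : Fin 14), C y ⊆ S → ∀ i ∉ S, (A.succAbove i, y) ∈ H := by
    intro S y hS i hi
    by_contra hcon
    exact hi (hS (by simp [hC, hcon]))
  refine zCore' C (fun y => (A, y) ∈ H) ?_ ?_ (by omega) ?_
  · intro S hS B hB h
    refine hfree (Sᶜ.map A.succAboveEmb) B ?_ hB ?_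
    · rw [Finset.card_map, Finset.card_compl, hS]; rfl
    · intro x hx y hy
      obtain ⟨i, hi, rfl⟩ := Finset.mem_map.1 hx
      exact hmem S y (h y hy) i (Finset.mem_compl.1 hi)
  · intro S hS B hB h
    refine hfree (insert A (Sᶜ.map A.succAboveEmb)) B ?_ hB ?_
    · rw [Finset.card_insert_of_notMem, Finset.card_map, Finset.card_compl, hS]
      · rfl
      · intro hm
        obtain ⟨i, _, hi⟩ := Finset.mem_map.1 hm
        exact Fin.succAbove_ne A i hi
    · intro x hx y hy
      rcases Finset.mem_insert.1 hx with rfl | hx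
      · exact (h y hy).1
      · obtain ⟨i, hi, rfl⟩ := Finset.mem_map.1 hx
        exact hmem S y (h y hy).2 i (Finset.mem_compl.1 hi)
  · by_cases h8 : ∑ y, I A y ≤ 8
    · left; omega
    · right
      intro B hB
      have h1 : ∑ y, I A y = (Finset.univ.filter (fun y => (A, y) ∈ H)).card := by
        simp [hI]
      have h2 := Finset.card_filter_add_card_filter_not (s := (Finset.univ : Finset (Fin 14)))
        (fun y => (A, y) ∈ H)
      rw [Finset.card_univ, Fintype.card_fin] at h2
      have h3 : B.card ≤ (Finset.univ.filter (fun y => ¬ (A, y) ∈ H)).card :=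
        Finset.card_le_card (fun y hy => by simpa using hB y hy)
      omega

theorem zPart1 (G : Finset (Fin 9 × Fin 14)) (hG : ¬ ContainsK 9 14 2 2 G) : G.card ≤ 39 := by
  set D : Fin 14 → Finset (Fin 9) := fun y => Finset.univ.filter (fun x => (x, y) ∈ G) with hD
  have hcard : G.card = ∑ y, (D y).card := by
    have h1 : ∑ x, ∑ y, (if (x, y) ∈ G then 1 else 0 : ℕ) = G.card := by
      rw [← Fintype.sum_prod_type']
      simp
    rw [← h1, Finset.sum_comm]
    apply Finset.sum_congr rfl
    intro y _
    simp [hD]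
  have hdis : (((Finset.univ : Finset (Fin 14)) : Set (Fin 14))).PairwiseDisjoint
      (fun y => (D y).powersetCard 2) := by
    intro y _ z _ hyz
    rw [Function.onFun, Finset.disjoint_left]
    intro P hP hP'
    rw [Finset.mem_powersetCard] at hP hP'
    refine hG ⟨P, {y, z}, hP.2, Finset.card_pair hyz, ?_⟩
    intro x hx w hw
    rcases Finset.mem_insert.1 hw with rfl | hw
    · simpa [hD] using hP.1 hx
    · rw [Finset.mem_singleton] at hw
      subst hw
      simpa [hD] using hP'.1 hx
  have hle : ∑ y, (D y).card.choose 2 ≤ 36 := by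
    have h1 : (Finset.univ.biUnion (fun y => (D y).powersetCard 2)).card ≤
        ((Finset.univ : Finset (Fin 9)).powersetCard 2).card := by
      apply Finset.card_le_card
      intro P hP
      obtain ⟨y, _, hy⟩ := Finset.mem_biUnion.1 hP
      rw [Finset.mem_powersetCard] at hy ⊢
      exact ⟨Finset.subset_univ _, hy.2⟩
    rw [Finset.card_biUnion hdis, Finset.card_powersetCard, Finset.card_univ, Fintype.card_fin] at h1
    simp only [Finset.card_powersetCard] at h1
    exact h1
  have hpt : ∀ y, 2 * (D y).card ≤ (D y).card.choose 2 + 3 := by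
    intro y
    have h9 : (D y).card ≤ 9 := by
      have := Finset.card_le_univ (D y)
      simpa using this
    generalize (D y).card = d at h9
    interval_cases d <;> decide
  have h2 : ∑ y, 2 * (D y).card ≤ ∑ y, ((D y).card.choose 2 + 3) :=
    Finset.sum_le_sum (fun y _ => hpt y)
  rw [← Finset.mul_sum, Finset.sum_add_distrib] at h2
  simp at h2
  omega

/-- z((9,14), K_{2,2}) ≤ 39 and z((9,14), K_{4,4}) ≤ 88. -/
theorem zarankiewicz_9_14 :
    (∀ G : Finset (Fin 9 × Fin 14), ¬ ContainsK 9 14 2 2 G → G.card ≤ 39) ∧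
    (∀ G : Finset (Fin 9 × Fin 14), ¬ ContainsK 9 14 4 4 G → G.card ≤ 88) := by
  exact ⟨zPart1, zPart2⟩
end
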